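/- Let C be a bounded open convex domain in ℝ². If there exists M > 0 such that every ideal triangle in (C, d_C) has Hilbert area at most M, and if every ball of radius 1 in any 2-dimensional Hilbert geometry has Hilbert area at least c₂ > 0, and if non-strict convexity of ∂C implies existence of ideal triangles of arbitrarily large area, then (C, d_C) is δ-hyperbolic for every δ > 4M/c₂ (in the thin-triangles sense with constant δ). -/

import Mathlib

open MeasureTheory
open scoped ENNReal Classical

/-- Hilbert Finsler norm `F_C(p,v) = (1/2)(1/t⁺ + 1/t⁻)` via the exit times of the
line through `p` with direction `±v`. -/
noncomputable def hilbertFinsler {E : Type*} [NormedAddCommGroup E] [NormedSpace ℝ E]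
    (C : Set E) (p v : E) : ℝ :=
  if v = 0 then 0 else
    (1 / 2) * (1 / sSup {t : ℝ | 0 < t ∧ p + t • v ∈ C}
      + 1 / sSup {t : ℝ | 0 < t ∧ p - t • v ∈ C})

/-- Unit ball of the Hilbert Finsler norm at `p`. -/
noncomputable def hilbertUnitBall {E : Type*} [NormedAddCommGroup E] [NormedSpace ℝ E]
    (C : Set E) (p : E) : Set E :=
  {v | hilbertFinsler C p v < 1}

/-- Hilbert distance `d_C(p,q) = (1/2) log [a,p,q,b]` via exit times. -/
noncomputable def hilbertDist {E : Type*} [NormedAddCommGroup E] [NormedSpace ℝ E]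
    (C : Set E) (p q : E) : ℝ :=
  if p = q then 0 else
    (1 / 2) * Real.log
      (((1 + sSup {t : ℝ | 0 < t ∧ p - t • (q - p) ∈ C}) /
          sSup {t : ℝ | 0 < t ∧ p - t • (q - p) ∈ C}) *
        (sSup {t : ℝ | 0 < t ∧ p + t • (q - p) ∈ C} /
          (sSup {t : ℝ | 0 < t ∧ p + t • (q - p) ∈ C} - 1)))

/-- Hilbert (Busemann) measure of a planar convex domain, with `ω₂ = π`. -/
noncomputable def hilbertMeasure (C : Set (ℝ × ℝ)) (A : Set (ℝ × ℝ)) : ℝ≥0∞ :=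
  ∫⁻ p in A, ENNReal.ofReal Real.pi / volume (hilbertUnitBall C p)

/-- An ideal triangle of `C` with vertices `x, y, z`: the vertices are on the boundary,
not collinear, and the closed affine triangle meets the boundary exactly at the vertices. -/
def IsIdealTriangle (C : Set (ℝ × ℝ)) (x y z : ℝ × ℝ) : Prop :=
  x ∈ frontier C ∧ y ∈ frontier C ∧ z ∈ frontier C ∧
    ¬ Collinear ℝ ({x, y, z} : Set (ℝ × ℝ)) ∧
    convexHull ℝ ({x, y, z} : Set (ℝ × ℝ)) ∩ frontier C = {x, y, z}

/-- `δ`-hyperbolicity in the thin-triangles sense for a (strictly convex) Hilbert geometry,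
where geodesics are straight segments: each side of every triangle is in the
`δ`-neighborhood of the union of the other two sides. -/
def IsDeltaHyperbolic (C : Set (ℝ × ℝ)) (δ : ℝ) : Prop :=
  ∀ a ∈ C, ∀ b ∈ C, ∀ c ∈ C, ∀ p ∈ segment ℝ a b,
    ∃ x ∈ segment ℝ b c ∪ segment ℝ c a, hilbertDist C p x ≤ δ

lemma isOpen_shift {E : Type*} [NormedAddCommGroup E] {C : Set E} {p : E}
    (hopen : IsOpen C) : IsOpen ((fun w => p + w) ⁻¹' C) :=
  hopen.preimage (by fun_prop)

lemma shift_mem_nhds {E : Type*} [NormedAddCommGroup E] {C : Set E} {p : E}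
    (hopen : IsOpen C) (hp : p ∈ C) : ((fun w => p + w) ⁻¹' C) ∈ nhds 0 :=
  (isOpen_shift hopen).mem_nhds (by simpa using hp)

section Funk

variable {E : Type*} [NormedAddCommGroup E] [NormedSpace ℝ E]

/-- The Funk norm at `p`: the Minkowski gauge of `C` seen from `p`. -/
noncomputable def funk (C : Set E) (p v : E) : ℝ :=
  gauge ((fun w => p + w) ⁻¹' C) v

variable {C : Set E} {p q r v w : E}

lemma convex_shift (hconv : Convex ℝ C) : Convex ℝ ((fun w => p + w) ⁻¹' C) :=
  hconv.translate_preimage_right p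

lemma funk_nonneg : 0 ≤ funk C p v := gauge_nonneg _

lemma funk_zero : funk C p 0 = 0 := gauge_zero

lemma funk_smul {t : ℝ} (ht : 0 ≤ t) : funk C p (t • v) = t * funk C p v :=
  gauge_smul_of_nonneg ht v

lemma funk_add_le (hopen : IsOpen C) (hconv : Convex ℝ C) (hp : p ∈ C) :
    funk C p (v + w) ≤ funk C p v + funk C p w :=
  gauge_add_le (convex_shift hconv) (absorbent_nhds_zero (shift_mem_nhds hopen hp)) v w

lemma continuous_funk (hopen : IsOpen C) (hconv : Convex ℝ C) (hp : p ∈ C) :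
    Continuous (funk C p) :=
  continuous_gauge (convex_shift hconv) (shift_mem_nhds hopen hp)

lemma funk_pos (hopen : IsOpen C) (hbdd : Bornology.IsBounded C) (hp : p ∈ C) (hv : v ≠ 0) :
    0 < funk C p v := by
  refine (gauge_pos (absorbent_nhds_zero (shift_mem_nhds hopen hp)) ?_).2 hv
  rw [NormedSpace.isVonNBounded_iff]
  have h := hbdd.vadd (-p)
  refine h.subset fun w hw => ?_
  exact ⟨p + w, hw, by simp⟩

lemma funk_lt_one_iff (hopen : IsOpen C) (hconv : Convex ℝ C) (hp : p ∈ C) :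
    funk C p v < 1 ↔ p + v ∈ C := by
  have h := setOfPred_gauge_lt_one_eq_self_of_isOpen (convex_shift (p := p) hconv)
    (by simpa using hp) (isOpen_shift hopen)
  exact Set.ext_iff.1 h v

lemma le_funk_mul (hopen : IsOpen C) (hconv : Convex ℝ C) (hp : p ∈ C)
    {l : E →L[ℝ] ℝ} {s : ℝ} (hl : ∀ x ∈ C, l x < s) (v : E) :
    l v ≤ funk C p v * (s - l p) := by
  have hs : 0 < s - l p := sub_pos.2 (hl p hp)
  refine le_of_forall_pos_lt_add fun ε hε => ?_
  have hr : 0 < funk C p v + ε / (s - l p) := add_pos_of_nonneg_of_pos funk_nonneg (by positivity)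
  have hmem : p + (funk C p v + ε / (s - l p))⁻¹ • v ∈ C := by
    rw [← funk_lt_one_iff hopen hconv hp, funk_smul (by positivity), inv_mul_lt_one₀ hr]
    linarith [div_pos hε hs]
  have h := hl _ hmem
  rw [map_add, map_smul, smul_eq_mul, ← lt_sub_iff_add_lt', inv_mul_lt_iff₀ hr] at h
  calc l v < _ := h
    _ = _ := by field_simp

lemma exists_support (hopen : IsOpen C) (hconv : Convex ℝ C) (hbdd : Bornology.IsBounded C)
    (hp : p ∈ C) (v : E) :
    ∃ l : E →L[ℝ] ℝ, (∀ x ∈ C, l x < l p + 1) ∧ l v = funk C p v := by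
  rcases eq_or_ne v 0 with rfl | hv
  · exact ⟨0, by simp, by simp [funk_zero]⟩
  have hg := funk_pos hopen hbdd hp hv
  have hx : p + (funk C p v)⁻¹ • v ∉ C := by
    rw [← funk_lt_one_iff hopen hconv hp, funk_smul (by positivity), inv_mul_cancel₀ hg.ne']
    exact lt_irrefl _
  obtain ⟨f, hf⟩ := geometric_hahn_banach_open_point hconv hopen hx
  have h0 := hf p hp
  simp only [map_add, map_smul, smul_eq_mul] at hf h0
  have hk : 0 < (funk C p v)⁻¹ * f v := by linarith
  refine ⟨((funk C p v)⁻¹ * f v)⁻¹ • f, fun x hx => ?_, ?_⟩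
  · simp only [smul_apply, smul_eq_mul]
    rw [inv_mul_lt_iff₀ hk, mul_add, mul_inv_cancel_left₀ hk.ne', mul_one]
    exact hf x hx
  · have : f v ≠ 0 := fun h => by simp [h] at hk
    simp only [smul_apply, smul_eq_mul]
    field_simp

lemma sSup_exit (hopen : IsOpen C) (hconv : Convex ℝ C) (hbdd : Bornology.IsBounded C)
    (hp : p ∈ C) (hv : v ≠ 0) :
    sSup {t : ℝ | 0 < t ∧ p + t • v ∈ C} = (funk C p v)⁻¹ := by
  have hg := funk_pos hopen hbdd hp hv
  have : {t : ℝ | 0 < t ∧ p + t • v ∈ C} = Set.Ioo 0 (funk C p v)⁻¹ := by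
    ext t
    refine and_congr_right fun ht => ?_
    rw [← funk_lt_one_iff hopen hconv hp, funk_smul ht.le, lt_inv_comm₀ ht hg, ← one_div,
      lt_div_iff₀ ht, mul_comm]
  rw [this, csSup_Ioo (by positivity)]

lemma sSup_exit_neg (hopen : IsOpen C) (hconv : Convex ℝ C) (hbdd : Bornology.IsBounded C)
    (hp : p ∈ C) (hv : v ≠ 0) :
    sSup {t : ℝ | 0 < t ∧ p - t • v ∈ C} = (funk C p (-v))⁻¹ := by
  rw [← sSup_exit hopen hconv hbdd hp (neg_ne_zero.2 hv)]
  simp [sub_eq_add_neg]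

lemma hilbertFinsler_eq (hopen : IsOpen C) (hconv : Convex ℝ C) (hbdd : Bornology.IsBounded C)
    (hp : p ∈ C) (v : E) :
    hilbertFinsler C p v = (funk C p v + funk C p (-v)) / 2 := by
  rcases eq_or_ne v 0 with rfl | hv
  · simp [hilbertFinsler, funk_zero]
  · rw [hilbertFinsler, if_neg hv, sSup_exit hopen hconv hbdd hp hv,
      sSup_exit_neg hopen hconv hbdd hp hv]
    simp only [one_div, inv_inv]
    ring

lemma hilbertDist_eq (hopen : IsOpen C) (hconv : Convex ℝ C) (hbdd : Bornology.IsBounded C)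
    (hp : p ∈ C) (hq : q ∈ C) :
    hilbertDist C p q =
      1 / 2 * Real.log ((1 + funk C p (-(q - p))) / (1 - funk C p (q - p))) := by
  rcases eq_or_ne p q with rfl | hpq
  · simp [hilbertDist, funk_zero]
  · have hv : q - p ≠ 0 := sub_ne_zero.2 hpq.symm
    rw [hilbertDist, if_neg hpq, sSup_exit hopen hconv hbdd hp hv,
      sSup_exit_neg hopen hconv hbdd hp hv]
    have h1 := funk_pos hopen hbdd hp hv
    have h2 := funk_pos hopen hbdd hp (neg_ne_zero.2 hv)
    have h3 : funk C p (q - p) < 1 := by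
      rw [funk_lt_one_iff hopen hconv hp]; simpa using hq
    congr 2
    have : (1 - funk C p (q - p)) ≠ 0 := by linarith
    have h4 : (funk C p (q - p))⁻¹ - 1 ≠ 0 := by
      have := one_lt_inv_iff₀.2 ⟨h1, h3⟩
      linarith
    field_simp
    ring

lemma half_log_le_hilbertDist (hopen : IsOpen C) (hconv : Convex ℝ C)
    (hbdd : Bornology.IsBounded C) (hp : p ∈ C) (hq : q ∈ C) {l l' : E →L[ℝ] ℝ} {s s' : ℝ}
    (hl : ∀ x ∈ C, l x < s) (hl' : ∀ x ∈ C, l' x < s') :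
    1 / 2 * Real.log ((s' - l' q) / (s' - l' p) / ((s - l q) / (s - l p))) ≤
      hilbertDist C p q := by
  rw [hilbertDist_eq hopen hconv hbdd hp hq]
  have h1 := le_funk_mul hopen hconv hp hl (q - p)
  have h2 := le_funk_mul hopen hconv hp hl' (-(q - p))
  have h3 : funk C p (q - p) < 1 := by
    rw [funk_lt_one_iff hopen hconv hp]; simpa using hq
  simp only [map_neg, map_sub] at h1 h2
  have a1 := sub_pos.2 (hl p hp)
  have a2 := sub_pos.2 (hl q hq)
  have a3 := sub_pos.2 (hl' p hp)
  have a4 := sub_pos.2 (hl' q hq)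
  have h4 : 0 < 1 - funk C p (q - p) := by linarith
  gcongr
  · linarith [funk_nonneg (C := C) (p := p) (v := -(q - p))]
  · rw [div_le_iff₀ a3]; linarith
  · rw [le_div_iff₀ a1]; linarith

/-- The Hilbert distance is realised by a pair of supporting functionals. -/
lemma exists_hilbertDist_eq (hopen : IsOpen C) (hconv : Convex ℝ C)
    (hbdd : Bornology.IsBounded C) (hp : p ∈ C) (hq : q ∈ C) :
    ∃ l l' : E →L[ℝ] ℝ, ∃ s s' : ℝ, (∀ x ∈ C, l x < s) ∧ (∀ x ∈ C, l' x < s') ∧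
      hilbertDist C p q =
        1 / 2 * Real.log ((s' - l' q) / (s' - l' p) / ((s - l q) / (s - l p))) := by
  obtain ⟨l, hl, e⟩ := exists_support hopen hconv hbdd hp (q - p)
  obtain ⟨l', hl', e'⟩ := exists_support hopen hconv hbdd hp (-(q - p))
  refine ⟨l, l', _, _, hl, hl', ?_⟩
  rw [hilbertDist_eq hopen hconv hbdd hp hq, ← e, ← e']
  simp only [map_neg, map_sub]
  congr 3 <;> ring

lemma hilbertDist_triangle (hopen : IsOpen C) (hconv : Convex ℝ C)
    (hbdd : Bornology.IsBounded C) (hp : p ∈ C) (hq : q ∈ C) (hr : r ∈ C) :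
    hilbertDist C p r ≤ hilbertDist C p q + hilbertDist C q r := by
  obtain ⟨l, l', s, s', hl, hl', e⟩ := exists_hilbertDist_eq hopen hconv hbdd hp hr
  have h1 := half_log_le_hilbertDist hopen hconv hbdd hp hq hl hl'
  have h2 := half_log_le_hilbertDist hopen hconv hbdd hq hr hl hl'
  have a := fun x hx => (sub_pos.2 (hl x hx)).ne'
  have a' := fun x hx => (sub_pos.2 (hl' x hx)).ne'
  rw [Real.log_div (div_ne_zero (a' _ hq) (a' _ hp)) (div_ne_zero (a _ hq) (a _ hp)),
    Real.log_div (a' _ hq) (a' _ hp), Real.log_div (a _ hq) (a _ hp)] at h1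
  rw [Real.log_div (div_ne_zero (a' _ hr) (a' _ hq)) (div_ne_zero (a _ hr) (a _ hq)),
    Real.log_div (a' _ hr) (a' _ hq), Real.log_div (a _ hr) (a _ hq)] at h2
  rw [e, Real.log_div (div_ne_zero (a' _ hr) (a' _ hp)) (div_ne_zero (a _ hr) (a _ hp)),
    Real.log_div (a' _ hr) (a' _ hp), Real.log_div (a _ hr) (a _ hp)]
  linarith

end Funk

section FinslerNorm

variable {E : Type*} [NormedAddCommGroup E] [NormedSpace ℝ E] {C : Set E} {p v w : E}

lemma hilbertFinsler_add_le (hopen : IsOpen C) (hconv : Convex ℝ C)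
    (hbdd : Bornology.IsBounded C) (hp : p ∈ C) :
    hilbertFinsler C p (v + w) ≤ hilbertFinsler C p v + hilbertFinsler C p w := by
  simp only [hilbertFinsler_eq hopen hconv hbdd hp, neg_add]
  linarith [funk_add_le (v := v) (w := w) hopen hconv hp,
    funk_add_le (v := -v) (w := -w) hopen hconv hp]

lemma hilbertFinsler_neg (hopen : IsOpen C) (hconv : Convex ℝ C)
    (hbdd : Bornology.IsBounded C) (hp : p ∈ C) :
    hilbertFinsler C p (-v) = hilbertFinsler C p v := by
  simp only [hilbertFinsler_eq hopen hconv hbdd hp, neg_neg, add_comm]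

lemma hilbertFinsler_smul (hopen : IsOpen C) (hconv : Convex ℝ C)
    (hbdd : Bornology.IsBounded C) (hp : p ∈ C) (t : ℝ) :
    hilbertFinsler C p (t • v) = |t| * hilbertFinsler C p v := by
  have key : ∀ t : ℝ, 0 ≤ t → hilbertFinsler C p (t • v) = t * hilbertFinsler C p v := by
    intro t ht
    simp only [hilbertFinsler_eq hopen hconv hbdd hp, ← smul_neg, funk_smul ht]
    ring
  rcases le_total 0 t with ht | ht
  · rw [key t ht, abs_of_nonneg ht]
  · rw [← hilbertFinsler_neg hopen hconv hbdd hp, ← neg_smul, key _ (neg_nonneg.2 ht),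
      abs_of_nonpos ht]

lemma hilbertFinsler_pos (hopen : IsOpen C) (hconv : Convex ℝ C)
    (hbdd : Bornology.IsBounded C) (hp : p ∈ C) (hv : v ≠ 0) : 0 < hilbertFinsler C p v := by
  rw [hilbertFinsler_eq hopen hconv hbdd hp]
  linarith [funk_pos hopen hbdd hp hv, funk_pos hopen hbdd hp (neg_ne_zero.2 hv)]

lemma isOpen_hilbertUnitBall (hopen : IsOpen C) (hconv : Convex ℝ C)
    (hbdd : Bornology.IsBounded C) (hp : p ∈ C) : IsOpen (hilbertUnitBall C p) := by
  have h : hilbertFinsler C p = fun v => (funk C p v + funk C p (-v)) / 2 :=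
    funext (hilbertFinsler_eq hopen hconv hbdd hp)
  have hc := continuous_funk hopen hconv hp
  have : Continuous (hilbertFinsler C p) := by rw [h]; fun_prop
  exact isOpen_lt this continuous_const

/-- Lower bound of the Finsler norm by functionals bounded on `C`. -/
lemma half_le_hilbertFinsler (hopen : IsOpen C) (hconv : Convex ℝ C)
    (hbdd : Bornology.IsBounded C) (hp : p ∈ C) {l l' : E →L[ℝ] ℝ} {s s' : ℝ}
    (hl : ∀ x ∈ C, l x < s) (hl' : ∀ x ∈ C, l' x < s') (v : E) :
    (l v / (s - l p) - l' v / (s' - l' p)) / 2 ≤ hilbertFinsler C p v := by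
  rw [hilbertFinsler_eq hopen hconv hbdd hp]
  have h1 := le_funk_mul hopen hconv hp hl v
  have h2 := le_funk_mul hopen hconv hp hl' (-v)
  rw [← div_le_iff₀ (sub_pos.2 (hl p hp))] at h1
  rw [← div_le_iff₀ (sub_pos.2 (hl' p hp)), map_neg, neg_div] at h2
  linarith

end FinslerNorm

lemma volume_le_of_slices {S : Set (ℝ × ℝ)} (hS : MeasurableSet S) {r d : ℝ} (hr : 0 ≤ r)
    (hSr : ∀ v ∈ S, |v.1| ≤ r) (hd : ∀ x y y', (x, y) ∈ S → (x, y') ∈ S → |y - y'| ≤ d) :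
    volume S ≤ ENNReal.ofReal (2 * r * d) := by
  rw [Measure.volume_eq_prod, Measure.prod_apply hS]
  have h : ∀ x, volume (Prod.mk x ⁻¹' S) ≤
      (Set.Icc (-r) r).indicator (fun _ => ENNReal.ofReal d) x := by
    intro x
    by_cases hx : x ∈ Set.Icc (-r) r
    · rw [Set.indicator_of_mem hx]
      refine (Real.volume_le_diam _).trans (Metric.ediam_le fun y hy y' hy' => ?_)
      rw [edist_dist]
      exact ENNReal.ofReal_le_ofReal (hd x y y' hy hy')
    · have : Prod.mk x ⁻¹' S = ∅ :=
        Set.eq_empty_of_forall_notMem fun y hy => hx (abs_le.1 (hSr _ hy))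
      simp [this]
  refine (lintegral_mono h).trans ?_
  rw [lintegral_indicator measurableSet_Icc, lintegral_const, Measure.restrict_apply_univ,
    Real.volume_Icc, mul_comm, ← ENNReal.ofReal_mul (by linarith)]
  apply le_of_eq
  congr 1
  ring

/-- The linear map `(ξ, η) ↦ ξ u + η w`. -/
noncomputable def frameMap (u w : ℝ × ℝ) : ℝ × ℝ →L[ℝ] ℝ × ℝ :=
  (ContinuousLinearMap.fst ℝ ℝ ℝ).smulRight u + (ContinuousLinearMap.snd ℝ ℝ ℝ).smulRight w

lemma frameMap_apply (u w z : ℝ × ℝ) : frameMap u w z = z.1 • u + z.2 • w := rfl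

lemma det_frameMap (u w : ℝ × ℝ) : (frameMap u w).det = u.1 * w.2 - w.1 * u.2 := by
  have : (frameMap u w : ℝ × ℝ →ₗ[ℝ] ℝ × ℝ) =
      Matrix.toLin (Module.Basis.finTwoProd ℝ) (Module.Basis.finTwoProd ℝ)
        !![u.1, w.1; u.2, w.2] := by
    rw [Matrix.toLin_finTwoProd]
    apply LinearMap.ext
    intro z
    apply Prod.ext <;> simp [frameMap_apply] <;> ring
  rw [ContinuousLinearMap.det, this, LinearMap.det_toLin, Matrix.det_fin_two_of]

lemma frameMap_surjective {u w : ℝ × ℝ} (h : u.1 * w.2 - w.1 * u.2 ≠ 0) :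
    Function.Surjective (frameMap u w) := by
  intro v
  refine ⟨((v.1 * w.2 - w.1 * v.2) / (u.1 * w.2 - w.1 * u.2),
    (u.1 * v.2 - v.1 * u.2) / (u.1 * w.2 - w.1 * u.2)), ?_⟩
  rw [frameMap_apply]
  apply Prod.ext <;> simp only [Prod.fst_add, Prod.smul_fst, Prod.snd_add, Prod.smul_snd,
    smul_eq_mul, div_mul_eq_mul_div, ← add_div, div_eq_iff h] <;> ring

section Density

variable {C : Set (ℝ × ℝ)} {q : ℝ × ℝ}

/-- Pointwise coarea inequality for the Busemann area. -/
lemma le_det_mul_density (hopen : IsOpen C) (hconv : Convex ℝ C)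
    (hbdd : Bornology.IsBounded C) (hq : q ∈ C) {u w : ℝ × ℝ}
    (hdet : u.1 * w.2 - w.1 * u.2 ≠ 0) {k : ℝ} (hk : 0 < k)
    (hkF : ∀ z : ℝ × ℝ, k * |z.1| ≤ hilbertFinsler C q (frameMap u w z)) :
    ENNReal.ofReal (Real.pi / 4 * (k * hilbertFinsler C q w)) ≤
      ENNReal.ofReal |(frameMap u w).det| *
        (ENNReal.ofReal Real.pi / volume (hilbertUnitBall C q)) := by
  have hw : w ≠ 0 := by rintro rfl; simp at hdet
  have hF := hilbertFinsler_pos hopen hconv hbdd hq hw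
  set F := hilbertFinsler C q w with hFdef
  have hdet' : 0 < |(frameMap u w).det| := by rw [det_frameMap]; exact abs_pos.2 hdet
  set D := |(frameMap u w).det| with hD
  have hvol : volume (hilbertUnitBall C q) ≤ ENNReal.ofReal (D * (4 / (k * F))) := by
    rw [← Set.image_preimage_eq (hilbertUnitBall C q) (frameMap_surjective hdet),
      Measure.addHaar_image_continuousLinearMap, ENNReal.ofReal_mul hdet'.le]
    refine mul_le_mul' le_rfl ?_
    have e : (4 / (k * F)) = 2 * (1 / k) * (2 / F) := by field_simp; ring
    rw [e]
    refine volume_le_of_slices ?_ (by positivity) ?_ ?_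
    · exact ((isOpen_hilbertUnitBall hopen hconv hbdd hq).preimage
        (frameMap u w).continuous).measurableSet
    · intro z hz
      have h1 : hilbertFinsler C q (frameMap u w z) < 1 := hz
      rw [le_div_iff₀ hk]
      linarith [hkF z]
    · intro x y y' hy hy'
      have h1 : hilbertFinsler C q (frameMap u w (x, y)) < 1 := hy
      have h2 : hilbertFinsler C q (frameMap u w (x, y')) < 1 := hy'
      have e : (y - y') • w = frameMap u w (x, y) + -frameMap u w (x, y') := by
        simp only [frameMap_apply]; module
      have h3 := hilbertFinsler_smul (v := w) hopen hconv hbdd hq (y - y')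
      rw [e] at h3
      have h4 := hilbertFinsler_add_le (v := frameMap u w (x, y)) (w := -frameMap u w (x, y'))
        hopen hconv hbdd hq
      rw [hilbertFinsler_neg hopen hconv hbdd hq] at h4
      rw [le_div_iff₀ hF]
      linarith
  calc ENNReal.ofReal (Real.pi / 4 * (k * F))
      = ENNReal.ofReal D * (ENNReal.ofReal Real.pi / ENNReal.ofReal (D * (4 / (k * F)))) := by
        rw [← ENNReal.ofReal_div_of_pos (by positivity), ← ENNReal.ofReal_mul hdet'.le]
        congr 1
        field_simp
    _ ≤ _ := by gcongr

lemma hilbertMeasure_mono {A B : Set (ℝ × ℝ)} (h : A ⊆ B) :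
    hilbertMeasure C A ≤ hilbertMeasure C B :=
  lintegral_mono_set h

end Density

lemma ofReal_integral_le_lintegral {X : Type*} [MeasurableSpace X] {μ : Measure X} {g : X → ℝ}
    (hg : Integrable g μ) : ENNReal.ofReal (∫ x, g x ∂μ) ≤ ∫⁻ x, ENNReal.ofReal (g x) ∂μ := by
  rw [integral_eq_lintegral_pos_part_sub_lintegral_neg_part hg]
  refine (ENNReal.ofReal_le_ofReal (sub_le_self _ ENNReal.toReal_nonneg)).trans ?_
  exact ENNReal.ofReal_toReal_le

lemma ofReal_sub_le_setLIntegral_of_hasDerivAt {G g : ℝ → ℝ} {a b : ℝ} (hab : a ≤ b)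
    (hG : ∀ x ∈ Set.Icc a b, HasDerivAt G (g x) x) (hg : ContinuousOn g (Set.Icc a b)) :
    ENNReal.ofReal (G b - G a) ≤ ∫⁻ x in Set.Ioo a b, ENNReal.ofReal (g x) := by
  rw [← Set.uIcc_of_le hab] at hG hg
  have hi := hg.intervalIntegrable (μ := volume)
  rw [← intervalIntegral.integral_eq_sub_of_hasDerivAt hG hi,
    intervalIntegral.integral_of_le hab, setLIntegral_congr Ioo_ae_eq_Ioc]
  exact ofReal_integral_le_lintegral ((intervalIntegrable_iff_integrableOn_Ioc_of_le hab).1 hi)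

section Fibers

variable {E : Type*} [NormedAddCommGroup E] [NormedSpace ℝ E] {C : Set E}

/-- The Finsler length of a segment is at least the Hilbert distance of its endpoints. -/
lemma hilbertDist_le_lintegral (hopen : IsOpen C) (hconv : Convex ℝ C)
    (hbdd : Bornology.IsBounded C) {m W : E} {Y : ℝ} (hY : 0 < Y) (hm : m ∈ C)
    (hx : m + Y • W ∈ C) :
    ENNReal.ofReal (hilbertDist C m (m + Y • W)) ≤
      ∫⁻ y in Set.Ioo 0 Y, ENNReal.ofReal (hilbertFinsler C (m + y • W) W) := by
  have hmem : ∀ y ∈ Set.Icc 0 Y, m + y • W ∈ C := by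
    intro y hy
    have h := hconv.add_smul_mem hm hx (t := y / Y)
      ⟨div_nonneg hy.1 hY.le, (div_le_one hY).2 hy.2⟩
    rwa [smul_smul, div_mul_cancel₀ _ hY.ne'] at h
  obtain ⟨l, l', s, s', hl, hl', e⟩ := exists_hilbertDist_eq hopen hconv hbdd hm hx
  have a := fun y hy => sub_pos.2 (hl _ (hmem y hy))
  have a' := fun y hy => sub_pos.2 (hl' _ (hmem y hy))
  have h0 : (0 : ℝ) ∈ Set.Icc 0 Y := ⟨le_rfl, hY.le⟩
  have h1 : Y ∈ Set.Icc 0 Y := ⟨hY.le, le_rfl⟩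
  let G : ℝ → ℝ := fun y => (Real.log (s' - l' (m + y • W)) - Real.log (s - l (m + y • W))) / 2
  let g : ℝ → ℝ := fun y => (l W / (s - l (m + y • W)) - l' W / (s' - l' (m + y • W))) / 2
  have hGd : ∀ y ∈ Set.Icc 0 Y, HasDerivAt G (g y) y := by
    intro y hy
    have hd : ∀ (f : E →L[ℝ] ℝ) (r : ℝ), HasDerivAt (fun y : ℝ => r - f (m + y • W)) (-f W) y := by
      intro f r
      simp only [map_add, map_smul, smul_eq_mul]
      simpa using (((hasDerivAt_id y).mul_const (f W)).const_add (f m)).const_sub r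
    have := ((((hd l' s').log (a' y hy).ne').sub ((hd l s).log (a y hy).ne')).div_const 2)
    refine this.congr_deriv ?_
    simp only [g]
    ring
  have hgc : ContinuousOn g (Set.Icc 0 Y) := by
    have hc : ∀ (f : E →L[ℝ] ℝ) (r : ℝ), Continuous (fun y : ℝ => r - f (m + y • W)) := by
      intro f r; fun_prop
    refine ContinuousOn.div_const (ContinuousOn.sub ?_ ?_) 2
    · exact continuousOn_const.div (hc l s).continuousOn fun y hy => (a y hy).ne'
    · exact continuousOn_const.div (hc l' s').continuousOn fun y hy => (a' y hy).ne'
  have hd : hilbertDist C m (m + Y • W) = G Y - G 0 := by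
    have b0 := a 0 h0
    have b0' := a' 0 h0
    rw [zero_smul, add_zero] at b0 b0'
    rw [e, Real.log_div (div_ne_zero (a' Y h1).ne' b0'.ne') (div_ne_zero (a Y h1).ne' b0.ne'),
      Real.log_div (a' Y h1).ne' b0'.ne', Real.log_div (a Y h1).ne' b0.ne']
    simp only [G, zero_smul, add_zero]
    ring
  rw [hd]
  refine (ofReal_sub_le_setLIntegral_of_hasDerivAt hY.le hGd hgc).trans ?_
  refine setLIntegral_mono' measurableSet_Ioo fun y hy => ENNReal.ofReal_le_ofReal ?_
  exact half_le_hilbertFinsler hopen hconv hbdd (hmem y ⟨hy.1.le, hy.2.le⟩) hl hl' W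

lemma measurable_exit {X : Type*} [TopologicalSpace X] [MeasurableSpace X]
    [OpensMeasurableSpace X] (hopen : IsOpen C) (hbdd : Bornology.IsBounded C) {P V : X → E}
    (hP : Continuous P) (hV : Continuous V) (hV0 : ∀ x, V x ≠ 0) :
    Measurable fun x => sSup {t : ℝ | 0 < t ∧ P x + t • V x ∈ C} := by
  obtain ⟨R, hR⟩ := hbdd.exists_norm_le
  refine measurable_of_Ioi fun s => ?_
  rcases lt_or_ge s 0 with hs | hs
  · convert MeasurableSet.univ
    refine Set.eq_univ_of_forall fun x => ?_
    exact hs.trans_le (Real.sSup_nonneg fun t ht => ht.1.le)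
  · have : (fun x => sSup {t : ℝ | 0 < t ∧ P x + t • V x ∈ C}) ⁻¹' Set.Ioi s =
        ⋃ t ∈ Set.Ioi s, (fun x => P x + t • V x) ⁻¹' C := by
      ext x
      simp only [Set.mem_preimage, Set.mem_Ioi, Set.mem_iUnion, exists_prop]
      constructor
      · intro h
        have hne : {t : ℝ | 0 < t ∧ P x + t • V x ∈ C}.Nonempty := by
          by_contra hne
          rw [Set.not_nonempty_iff_eq_empty] at hne
          rw [hne, Real.sSup_empty] at h
          exact absurd h hs.not_gt
        obtain ⟨t, ht, hst⟩ := exists_lt_of_lt_csSup hne h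
        exact ⟨t, hst, ht.2⟩
      · rintro ⟨t, hst, ht⟩
        refine hst.trans_le (le_csSup ⟨(R + ‖P x‖) / ‖V x‖, ?_⟩ ⟨hs.trans_lt hst, ht⟩)
        rintro r ⟨hr, hrC⟩
        rw [le_div_iff₀ (norm_pos_iff.2 (hV0 x))]
        calc r * ‖V x‖ = ‖(P x + r • V x) - P x‖ := by
              rw [add_sub_cancel_left, norm_smul, Real.norm_of_nonneg hr.le]
          _ ≤ _ := (norm_sub_le _ _).trans (by linarith [hR _ hrC])
    rw [this]
    refine (isOpen_biUnion fun t _ => hopen.preimage ?_).measurableSet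
    fun_prop

lemma measurable_hilbertFinsler {X : Type*} [TopologicalSpace X] [MeasurableSpace X]
    [OpensMeasurableSpace X] (hopen : IsOpen C) (hbdd : Bornology.IsBounded C) {P V : X → E}
    (hP : Continuous P) (hV : Continuous V) (hV0 : ∀ x, V x ≠ 0) :
    Measurable fun x => hilbertFinsler C (P x) (V x) := by
  simp only [hilbertFinsler, hV0, if_false]
  have h1 := measurable_exit hopen hbdd hP hV hV0
  have h2 := measurable_exit hopen hbdd hP hV.neg fun x => neg_ne_zero.2 (hV0 x)
  simp only [Pi.neg_apply, smul_neg, ← sub_eq_add_neg] at h2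
  fun_prop

end Fibers

lemma hasDerivAt_mul_abs_self (x : ℝ) : HasDerivAt (fun x : ℝ => x * |x|) (2 * |x|) x := by
  rcases lt_trichotomy x 0 with hx | rfl | hx
  · have h := (hasDerivAt_id x).mul (hasDerivAt_abs_neg hx)
    refine (h.congr_deriv ?_)
    simp [abs_of_neg hx]; ring
  · rw [hasDerivAt_iff_isLittleO_nhds_zero]
    simp only [zero_add, abs_zero, mul_zero, sub_zero, smul_zero]
    rw [Asymptotics.isLittleO_iff]
    intro c hc
    filter_upwards [Metric.ball_mem_nhds (0 : ℝ) hc] with h hh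
    rw [mem_ball_zero_iff] at hh
    simp only [norm_mul, norm_abs_eq_norm]
    exact (mul_comm _ _).le.trans (mul_le_mul_of_nonneg_right hh.le (norm_nonneg _))
  · have h := (hasDerivAt_id x).mul (hasDerivAt_abs_pos hx)
    refine (h.congr_deriv ?_)
    simp [abs_of_pos hx]; ring

/-- Signed Hilbert arclength on a chord whose ends are at parameters `-1 / a` and `1 / b`. -/
noncomputable def chordArc (a b τ : ℝ) : ℝ := (Real.log (1 + a * τ) - Real.log (1 - b * τ)) / 2

/-- Derivative of `chordArc`. -/
noncomputable def chordSpeed (a b τ : ℝ) : ℝ := (a / (1 + a * τ) + b / (1 - b * τ)) / 2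

lemma hasDerivAt_chordArc {a b τ : ℝ} (h1 : 0 < 1 + a * τ) (h2 : 0 < 1 - b * τ) :
    HasDerivAt (chordArc a b) (chordSpeed a b τ) τ := by
  have d1 : HasDerivAt (fun τ : ℝ => 1 + a * τ) a τ := by
    simpa using ((hasDerivAt_id τ).const_mul a).const_add 1
  have d2 : HasDerivAt (fun τ : ℝ => 1 - b * τ) (-b) τ := by
    simpa using ((hasDerivAt_id τ).const_mul b).const_sub 1
  refine (((d1.log h1.ne').sub (d2.log h2.ne')).div_const 2).congr_deriv ?_
  rw [chordSpeed]; ring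

lemma sq_le_lintegral_chord {a b δ τ₁ τ₂ : ℝ} (ha : 0 < a) (hb : 0 < b) (h21 : τ₂ ≤ τ₁)
    (h1 : 0 < 1 - b * τ₁) (h2 : 0 < 1 + a * τ₂) (hδ1 : chordArc a b τ₁ = δ)
    (hδ2 : chordArc a b τ₂ = -δ) (hδ : 0 ≤ δ) :
    ENNReal.ofReal (Real.pi / 4 * δ ^ 2) ≤ ∫⁻ τ in Set.Ioo τ₂ τ₁,
      ENNReal.ofReal (Real.pi / 4 * chordSpeed a b τ * (δ - |chordArc a b τ|)) := by
  have p1 : ∀ τ ∈ Set.Icc τ₂ τ₁, 0 < 1 + a * τ := fun τ hτ => by nlinarith [hτ.1]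
  have p2 : ∀ τ ∈ Set.Icc τ₂ τ₁, 0 < 1 - b * τ := fun τ hτ => by nlinarith [hτ.2]
  have hd := fun τ hτ => hasDerivAt_chordArc (p1 τ hτ) (p2 τ hτ)
  have key := ofReal_sub_le_setLIntegral_of_hasDerivAt
    (G := fun τ => Real.pi / 4 *
      (δ * chordArc a b τ - (chordArc a b τ * |chordArc a b τ|) / 2))
    (g := fun τ => Real.pi / 4 * chordSpeed a b τ * (δ - |chordArc a b τ|)) h21 ?_ ?_
  · refine le_trans (le_of_eq ?_) key
    rw [hδ1, hδ2, abs_neg, abs_of_nonneg hδ]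
    congr 1
    ring
  · intro τ hτ
    have e := (hasDerivAt_mul_abs_self (chordArc a b τ)).comp τ (hd τ hτ)
    refine ((((hd τ hτ).const_mul δ).sub (e.div_const 2)).const_mul (Real.pi / 4)).congr_deriv ?_
    ring
  · have hc : ContinuousOn (chordArc a b) (Set.Icc τ₂ τ₁) :=
      fun τ hτ => (hd τ hτ).continuousAt.continuousWithinAt
    have hs : ContinuousOn (chordSpeed a b) (Set.Icc τ₂ τ₁) := by
      refine ContinuousOn.div_const (ContinuousOn.add ?_ ?_) 2
      · exact continuousOn_const.div (by fun_prop) fun y hy => (p1 y hy).ne'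
      · exact continuousOn_const.div (by fun_prop) fun y hy => (p2 y hy).ne'
    exact (continuousOn_const.mul hs).mul (continuousOn_const.sub hc.abs)

section Fan

/-- Coordinates adapted to the pencil of lines through `p - c⁻¹ w`. -/
noncomputable def fan (p e w : ℝ × ℝ) (c : ℝ) (z : ℝ × ℝ) : ℝ × ℝ :=
  p + (z.1 * (1 + c * z.2)) • e + z.2 • w

variable {p e w : ℝ × ℝ} {c : ℝ}

lemma fan_eq (τ y : ℝ) : fan p e w c (τ, y) = (p + τ • e) + y • ((c * τ) • e + w) := by
  simp only [fan]; module

lemma continuous_fan : Continuous (fan p e w c) := by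
  unfold fan; fun_prop

lemma hasFDerivAt_fan (z : ℝ × ℝ) : HasFDerivAt (fan p e w c)
    (frameMap ((1 + c * z.2) • e) ((c * z.1) • e + w)) z := by
  have h1 : HasFDerivAt (fun z : ℝ × ℝ => z.1) (ContinuousLinearMap.fst ℝ ℝ ℝ) z := hasFDerivAt_fst
  have h2 : HasFDerivAt (fun z : ℝ × ℝ => z.2) (ContinuousLinearMap.snd ℝ ℝ ℝ) z := hasFDerivAt_snd
  have h := (((h1.mul ((h2.const_mul c).const_add 1)).smul_const e).const_add p).add
    (h2.smul_const w)
  refine h.congr_fderiv ?_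
  apply ContinuousLinearMap.ext
  intro v
  simp [frameMap_apply]
  module

lemma fan_injOn (hdet : e.1 * w.2 - w.1 * e.2 ≠ 0) :
    Set.InjOn (fan p e w c) {z | 0 < 1 + c * z.2} := by
  rintro ⟨τ, y⟩ hz ⟨τ', y'⟩ - h
  simp only [fan, Prod.ext_iff, Prod.fst_add, Prod.snd_add, Prod.smul_fst, Prod.smul_snd,
    smul_eq_mul] at h
  obtain ⟨h1, h2⟩ := h
  have hy : y = y' := by
    have : (y - y') * (e.1 * w.2 - w.1 * e.2) = 0 := by linear_combination e.1 * h2 - e.2 * h1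
    rcases mul_eq_zero.1 this with h | h
    · linarith
    · exact absurd h hdet
  subst hy
  have hx : (τ - τ') * (1 + c * y) = 0 := by
    have : ((τ - τ') * (1 + c * y)) * (e.1 * w.2 - w.1 * e.2) = 0 := by
      linear_combination w.2 * h1 - w.1 * h2
    exact (mul_eq_zero.1 this).resolve_right hdet
  have hz' : (1 + c * y) ≠ 0 := ne_of_gt hz
  have := (mul_eq_zero.1 hx).resolve_right hz'
  rw [sub_eq_zero.1 this]

variable {C A : Set (ℝ × ℝ)} {l l' : ℝ × ℝ →L[ℝ] ℝ} {a b : ℝ}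

lemma support_fan_left (hlb : l e = b) (hlc : l w = -c) (z : ℝ × ℝ) :
    l p + 1 - l (fan p e w c z) = (1 + c * z.2) * (1 - b * z.1) := by
  simp only [fan, map_add, map_smul, smul_eq_mul, hlb, hlc]; ring

lemma support_fan_right (hla : l' e = -a) (hlc' : l' w = -c) (z : ℝ × ℝ) :
    l' p + 1 - l' (fan p e w c z) = (1 + c * z.2) * (1 + a * z.1) := by
  simp only [fan, map_add, map_smul, smul_eq_mul, hla, hlc']; ring

/-- The pencil coordinate is `1`-Lipschitz for the Finsler norm. -/
lemma chordSpeed_mul_le_hilbertFinsler (hopen : IsOpen C) (hconv : Convex ℝ C)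
    (hbdd : Bornology.IsBounded C) (hl : ∀ x ∈ C, l x < l p + 1) (hl' : ∀ x ∈ C, l' x < l' p + 1)
    (hlb : l e = b) (hla : l' e = -a) (hlc : l w = -c) (hlc' : l' w = -c) {z : ℝ × ℝ}
    (hz : fan p e w c z ∈ C) (h0 : 0 < 1 + c * z.2) (h1 : 0 < 1 + a * z.1)
    (h2 : 0 < 1 - b * z.1) (v : ℝ × ℝ) :
    chordSpeed a b z.1 * |v.1| ≤ hilbertFinsler C (fan p e w c z)
      (frameMap ((1 + c * z.2) • e) ((c * z.1) • e + w) v) := by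
  have key : ∀ v : ℝ × ℝ, chordSpeed a b z.1 * v.1 ≤ hilbertFinsler C (fan p e w c z)
      (frameMap ((1 + c * z.2) • e) ((c * z.1) • e + w) v) := by
    intro v
    refine le_trans (le_of_eq ?_) (half_le_hilbertFinsler hopen hconv hbdd hz hl hl' _)
    rw [support_fan_left hlb hlc, support_fan_right hla hlc', chordSpeed]
    simp only [frameMap_apply, map_add, map_smul, smul_eq_mul, hlb, hlc, hla, hlc']
    generalize 1 + c * z.2 = x at *
    have n1 := h0.ne'
    have n2 := h1.ne'
    have n3 := h2.ne'
    rw [div_add_div _ _ n2 n3, div_sub_div _ _ (mul_ne_zero n1 n3) (mul_ne_zero n1 n2), div_div,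
      div_div, div_mul_eq_mul_div, div_eq_div_iff (by positivity) (by positivity)]
    ring
  rcases le_total 0 v.1 with hv | hv
  · rw [abs_of_nonneg hv]; exact key v
  · rw [abs_of_nonpos hv]
    have := key (-v)
    rwa [map_neg, hilbertFinsler_neg hopen hconv hbdd hz] at this

/-- A region swept by long enough fibers of the pencil has area at least `π δ² / 4`. -/
lemma le_hilbertMeasure_of_fibers (hopen : IsOpen C) (hconv : Convex ℝ C)
    (hbdd : Bornology.IsBounded C) (hdet : e.1 * w.2 - w.1 * e.2 ≠ 0)
    (hl : ∀ x ∈ C, l x < l p + 1) (hl' : ∀ x ∈ C, l' x < l' p + 1)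
    (hlb : l e = b) (hla : l' e = -a) (hlc : l w = -c) (hlc' : l' w = -c)
    (ha : 0 < a) (hb : 0 < b) (hA : MeasurableSet A) (hAC : A ⊆ C) {δ τ₁ τ₂ : ℝ} (hδ : 0 ≤ δ)
    (h21 : τ₂ ≤ τ₁) (h1 : 0 < 1 - b * τ₁) (h2 : 0 < 1 + a * τ₂) (hδ1 : chordArc a b τ₁ = δ)
    (hδ2 : chordArc a b τ₂ = -δ)
    (hfib : ∀ τ ∈ Set.Ioo τ₂ τ₁, ∃ Y > 0, (∀ y ∈ Set.Ioo 0 Y, fan p e w c (τ, y) ∈ A) ∧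
      fan p e w c (τ, 0) ∈ C ∧ fan p e w c (τ, Y) ∈ C ∧
      δ ≤ |chordArc a b τ| + hilbertDist C (fan p e w c (τ, 0)) (fan p e w c (τ, Y))) :
    ENNReal.ofReal (Real.pi / 4 * δ ^ 2) ≤ hilbertMeasure C A := by
  have p1 : ∀ τ ∈ Set.Ioo τ₂ τ₁, 0 < 1 + a * τ := fun τ hτ => by nlinarith [hτ.1]
  have p2 : ∀ τ ∈ Set.Ioo τ₂ τ₁, 0 < 1 - b * τ := fun τ hτ => by nlinarith [hτ.2]
  have hk : ∀ τ ∈ Set.Ioo τ₂ τ₁, 0 < chordSpeed a b τ := fun τ hτ => by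
    have := p1 τ hτ
    have := p2 τ hτ
    unfold chordSpeed
    positivity
  let S : Set (ℝ × ℝ) := {z | z.1 ∈ Set.Ioo τ₂ τ₁ ∧ fan p e w c z ∈ A}
  have hS : MeasurableSet S :=
    (measurable_fst measurableSet_Ioo).inter (continuous_fan.measurable hA)
  have hS0 : ∀ z ∈ S, 0 < 1 + c * z.2 := by
    intro z hz
    have h := sub_pos.2 (hl _ (hAC hz.2))
    rw [support_fan_left hlb hlc] at h
    exact pos_of_mul_pos_left h (p2 _ hz.1).le
  let V : ℝ × ℝ → ℝ × ℝ := fun z => (c * z.1) • e + w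
  have hV0 : ∀ z, V z ≠ 0 := by
    intro z hz
    apply hdet
    simp only [V, Prod.ext_iff, Prod.fst_add, Prod.snd_add, Prod.smul_fst, Prod.smul_snd,
      smul_eq_mul, Prod.fst_zero, Prod.snd_zero] at hz
    linear_combination e.1 * hz.2 - e.2 * hz.1
  let f : ℝ × ℝ → ℝ≥0∞ := S.indicator fun z => ENNReal.ofReal (Real.pi / 4 *
    (chordSpeed a b z.1 * hilbertFinsler C (fan p e w c z) (V z)))
  have hf : Measurable f := by
    refine Measurable.indicator ?_ hS
    have := measurable_hilbertFinsler hopen hbdd (continuous_fan (p := p) (e := e) (w := w) (c := c))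
      (show Continuous V by fun_prop) hV0
    unfold chordSpeed
    fun_prop
  calc ENNReal.ofReal (Real.pi / 4 * δ ^ 2)
      ≤ ∫⁻ τ in Set.Ioo τ₂ τ₁,
        ENNReal.ofReal (Real.pi / 4 * chordSpeed a b τ * (δ - |chordArc a b τ|)) :=
        sq_le_lintegral_chord ha hb h21 h1 h2 hδ1 hδ2 hδ
    _ ≤ ∫⁻ τ in Set.Ioo τ₂ τ₁, ∫⁻ y, f (τ, y) := by
        refine setLIntegral_mono' measurableSet_Ioo fun τ hτ => ?_
        obtain ⟨Y, hY, hYA, h0, hYC, hd⟩ := hfib τ hτ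
        have hpk : 0 ≤ Real.pi / 4 * chordSpeed a b τ :=
          mul_nonneg (by positivity) (hk τ hτ).le
        simp only [fan_eq, zero_smul, add_zero] at h0 hYC hd
        calc ENNReal.ofReal (Real.pi / 4 * chordSpeed a b τ * (δ - |chordArc a b τ|))
            ≤ ENNReal.ofReal (Real.pi / 4 * chordSpeed a b τ) *
              ∫⁻ y in Set.Ioo 0 Y, ENNReal.ofReal
                (hilbertFinsler C ((p + τ • e) + y • V (τ, 0)) (V (τ, 0))) := by
              rw [ENNReal.ofReal_mul hpk]
              refine mul_le_mul' le_rfl (le_trans (ENNReal.ofReal_le_ofReal ?_)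
                (hilbertDist_le_lintegral hopen hconv hbdd hY h0 hYC))
              linarith
          _ = ∫⁻ y in Set.Ioo 0 Y, f (τ, y) := by
              rw [← lintegral_const_mul' _ _ ENNReal.ofReal_ne_top]
              refine setLIntegral_congr_fun measurableSet_Ioo fun y hy => ?_
              have hm : (τ, y) ∈ S := ⟨hτ, hYA y hy⟩
              simp only [f, Set.indicator_of_mem hm]
              rw [← ENNReal.ofReal_mul hpk, mul_assoc, fan_eq]
          _ ≤ _ := setLIntegral_le_lintegral _ _
    _ ≤ ∫⁻ τ, ∫⁻ y, f (τ, y) := setLIntegral_le_lintegral _ _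
    _ = ∫⁻ z, f z := by rw [Measure.volume_eq_prod, lintegral_prod _ hf.aemeasurable]
    _ ≤ ∫⁻ z in S, ENNReal.ofReal |(frameMap ((1 + c * z.2) • e) ((c * z.1) • e + w)).det| *
          (ENNReal.ofReal Real.pi / volume (hilbertUnitBall C (fan p e w c z))) := by
        rw [lintegral_indicator hS]
        refine setLIntegral_mono' hS fun z hz => ?_
        have h0 := hS0 z hz
        refine le_det_mul_density hopen hconv hbdd (hAC hz.2) ?_ (hk _ hz.1) fun v =>
          chordSpeed_mul_le_hilbertFinsler hopen hconv hbdd hl hl' hlb hla hlc hlc' (hAC hz.2) h0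
            (p1 _ hz.1) (p2 _ hz.1) v
        have : ((1 + c * z.2) • e).1 * ((c * z.1) • e + w).2 -
            ((c * z.1) • e + w).1 * ((1 + c * z.2) • e).2 =
            (1 + c * z.2) * (e.1 * w.2 - w.1 * e.2) := by
          simp; ring
        rw [this]
        exact mul_ne_zero h0.ne' hdet
    _ = hilbertMeasure C (fan p e w c '' S) := by
        rw [hilbertMeasure, lintegral_image_eq_lintegral_abs_det_fderiv_mul volume hS
          (fun z _ => (hasFDerivAt_fan z).hasFDerivWithinAt) ((fan_injOn hdet).mono hS0)]
    _ ≤ _ := hilbertMeasure_mono (Set.image_subset_iff.2 fun z hz => hz.2)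

end Fan

section Triangle

lemma mem_convexHull_triple {E : Type*} [AddCommGroup E] [Module ℝ E] {x y z q : E} :
    q ∈ convexHull ℝ ({x, y, z} : Set E) ↔
      ∃ α β γ : ℝ, 0 ≤ α ∧ 0 ≤ β ∧ 0 ≤ γ ∧ α + β + γ = 1 ∧ α • x + β • y + γ • z = q := by
  constructor
  · intro h
    rw [convexHull_insert (by simp), convexHull_pair, mem_convexJoin] at h
    obtain ⟨_, rfl, u, ⟨r, s, hr, hs, hrs, rfl⟩, t, v, ht, hv, htv, rfl⟩ := h
    refine ⟨t, v * r, v * s, ht, by positivity, by positivity, ?_, by module⟩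
    rw [add_assoc, ← mul_add, hrs, mul_one, htv]
  · rintro ⟨α, β, γ, hα, hβ, hγ, hs, rfl⟩
    have hc := convex_convexHull ℝ ({x, y, z} : Set E)
    have hx : x ∈ convexHull ℝ ({x, y, z} : Set E) := subset_convexHull _ _ (by simp)
    have hy : y ∈ convexHull ℝ ({x, y, z} : Set E) := subset_convexHull _ _ (by simp)
    have hz : z ∈ convexHull ℝ ({x, y, z} : Set E) := subset_convexHull _ _ (by simp)
    rcases eq_or_lt_of_le (add_nonneg hα hβ) with h | h
    · obtain rfl : α = 0 := by linarith
      obtain rfl : β = 0 := by linarith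
      obtain rfl : γ = 1 := by linarith
      simpa using hz
    · have hxy := hc hx hy (div_nonneg hα h.le) (div_nonneg hβ h.le) (by field_simp)
      have := hc hxy hz h.le hγ hs
      rwa [smul_add, smul_smul, smul_smul, mul_div_cancel₀ _ h.ne', mul_div_cancel₀ _ h.ne'] at this

variable {C : Set (ℝ × ℝ)} {a b c p : ℝ × ℝ} {δ : ℝ}

lemma exists_eq_add_smul_of_det_eq_zero {u v : ℝ × ℝ} (hu : u ≠ 0)
    (h : u.1 * v.2 - v.1 * u.2 = 0) : ∃ r : ℝ, v = r • u := by
  by_cases h1 : u.1 = 0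
  · have h2 : u.2 ≠ 0 := fun h2 => hu (Prod.ext h1 h2)
    refine ⟨v.2 / u.2, Prod.ext ?_ ?_⟩
    · have : v.1 = 0 := by
        rw [h1, zero_mul, zero_sub, neg_eq_zero] at h
        exact (mul_eq_zero.1 h).resolve_right h2
      simp [this, h1]
    · simp [h2]
  · refine ⟨v.1 / u.1, Prod.ext ?_ ?_⟩
    · simp [h1]
    · simp; field_simp; linarith

section Chord

variable {E : Type*} [NormedAddCommGroup E] [NormedSpace ℝ E] {C : Set E} {p e : E} {τ : ℝ}

lemma one_sub_funk_mul_pos (hopen : IsOpen C) (hconv : Convex ℝ C) (hp : p ∈ C)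
    (hτ : p + τ • e ∈ C) : 0 < 1 - funk C p e * τ := by
  rcases le_total 0 τ with h | h
  · rw [← funk_lt_one_iff hopen hconv hp, funk_smul h] at hτ
    linarith
  · nlinarith [funk_nonneg (C := C) (p := p) (v := e)]

lemma one_add_funk_mul_pos (hopen : IsOpen C) (hconv : Convex ℝ C) (hp : p ∈ C)
    (hτ : p + τ • e ∈ C) : 0 < 1 + funk C p (-e) * τ := by
  have := one_sub_funk_mul_pos (e := -e) (τ := -τ) hopen hconv hp (by simpa using hτ)
  linarith

lemma hilbertDist_eq_chordArc (hopen : IsOpen C) (hconv : Convex ℝ C)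
    (hbdd : Bornology.IsBounded C) (hp : p ∈ C) (h : 0 ≤ τ) (hτ : p + τ • e ∈ C) :
    hilbertDist C p (p + τ • e) = chordArc (funk C p (-e)) (funk C p e) τ := by
  have h1 := one_sub_funk_mul_pos hopen hconv hp hτ
  have h2 := one_add_funk_mul_pos hopen hconv hp hτ
  rw [hilbertDist_eq hopen hconv hbdd hp hτ, add_sub_cancel_left, ← smul_neg, funk_smul h,
    funk_smul h, mul_comm τ, mul_comm τ, Real.log_div h2.ne' h1.ne', chordArc]
  ring

lemma hilbertDist_eq_neg_chordArc (hopen : IsOpen C) (hconv : Convex ℝ C)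
    (hbdd : Bornology.IsBounded C) (hp : p ∈ C) (h : τ ≤ 0) (hτ : p + τ • e ∈ C) :
    hilbertDist C p (p + τ • e) = -chordArc (funk C p (-e)) (funk C p e) τ := by
  have := hilbertDist_eq_chordArc (e := -e) (τ := -τ) hopen hconv hbdd hp (by linarith)
    (by simpa using hτ)
  rw [neg_smul_neg] at this
  rw [this, chordArc, chordArc, neg_neg, mul_neg, mul_neg, ← sub_eq_add_neg, sub_neg_eq_add]
  ring

lemma hilbertDist_le_abs_chordArc (hopen : IsOpen C) (hconv : Convex ℝ C)
    (hbdd : Bornology.IsBounded C) (hp : p ∈ C) (hτ : p + τ • e ∈ C) :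
    hilbertDist C p (p + τ • e) ≤ |chordArc (funk C p (-e)) (funk C p e) τ| := by
  rcases le_total 0 τ with h | h
  · exact (hilbertDist_eq_chordArc hopen hconv hbdd hp h hτ).trans_le (le_abs_self _)
  · exact (hilbertDist_eq_neg_chordArc hopen hconv hbdd hp h hτ).trans_le (neg_le_abs _)

end Chord

/-- A point of a side which is far from the two other sides lies in a genuine triangle. -/
lemma det_ne_zero_of_far (hδ : 0 ≤ δ) {s : ℝ} (hs0 : 0 ≤ s) (hs1 : s ≤ 1)
    (hp : p = a + s • (b - a))
    (hfar : ∀ x ∈ segment ℝ b c ∪ segment ℝ c a, δ < hilbertDist C p x) :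
    (b - a).1 * (c - a).2 - (c - a).1 * (b - a).2 ≠ 0 := by
  have hself : p ∉ segment ℝ b c ∪ segment ℝ c a := by
    intro h
    have := hfar p h
    rw [hilbertDist, if_pos rfl] at this
    linarith
  intro h
  have hba : b - a ≠ 0 := by
    intro h
    rw [h, smul_zero, add_zero] at hp
    exact hself (Or.inr (hp ▸ right_mem_segment ℝ c a))
  obtain ⟨r, hr⟩ := exists_eq_add_smul_of_det_eq_zero hba h
  have hc : c = a + r • (b - a) := by rw [← hr]; abel
  rcases le_or_gt r s with hrs | hrs
  · refine hself (Or.inl ?_)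
    rcases eq_or_lt_of_le hs1 with rfl | hs1
    · rw [hp, one_smul, add_sub_cancel]
      exact left_mem_segment ℝ b c
    have h1 : 0 < 1 - r := by linarith
    refine ⟨(s - r) / (1 - r), (1 - s) / (1 - r), div_nonneg (by linarith) h1.le,
      div_nonneg (by linarith) h1.le, by field_simp; ring, ?_⟩
    have e1 : (s - r) / (1 - r) = 1 - (1 - s) / (1 - r) := by field_simp; ring
    have e2 : (1 - s) / (1 - r) * (1 - r) = 1 - s := by field_simp
    rw [hp, hc, e1]
    generalize (1 - s) / (1 - r) = θ at *
    obtain rfl : s = 1 - θ * (1 - r) := by linarith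
    module
  · refine hself (Or.inr ?_)
    have h1 : 0 < r := by linarith
    refine ⟨s / r, 1 - s / r, by positivity, sub_nonneg.2 ((div_le_one h1).2 hrs.le), by ring, ?_⟩
    have e2 : s / r * r = s := by field_simp
    rw [hp, hc]
    generalize s / r = θ at *
    subst e2
    module

lemma le_hilbertMeasure_triangle (hopen : IsOpen C) (hconv : Convex ℝ C)
    (hbdd : Bornology.IsBounded C) (ha : a ∈ C) (hb : b ∈ C) (hc : c ∈ C)
    (hpab : p ∈ segment ℝ a b) (hδ : 0 ≤ δ)
    (hfar : ∀ x ∈ segment ℝ b c ∪ segment ℝ c a, δ < hilbertDist C p x) :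
    ENNReal.ofReal (Real.pi / 4 * δ ^ 2) ≤
      hilbertMeasure C (convexHull ℝ ({a, b, c} : Set (ℝ × ℝ))) := by
  have hpC : p ∈ C := hconv.segment_subset ha hb hpab
  rw [segment_eq_image'] at hpab
  obtain ⟨s, ⟨hs0, hs1⟩, hp⟩ := hpab
  have hdet := det_ne_zero_of_far hδ hs0 hs1 hp.symm hfar
  have htC : ∀ τ ∈ Set.Icc (-s) (1 - s), p + τ • (b - a) ∈ C := by
    intro τ hτ
    have := hconv ha hb (a := 1 - s - τ) (b := s + τ) (by linarith [hτ.2]) (by linarith [hτ.1])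
      (by ring)
    convert this using 1
    rw [← hp]
    module
  have hpb : p + (1 - s) • (b - a) = b := by rw [← hp]; module
  have hpa : p + (-s) • (b - a) = a := by rw [← hp]; module
  have hmem0 : (0 : ℝ) ∈ Set.Icc (-s) (1 - s) := ⟨by linarith, by linarith⟩
  set e := b - a with he
  have hdb := hfar b (Or.inl (left_mem_segment ℝ b c))
  have hda := hfar a (Or.inr (right_mem_segment ℝ c a))
  rw [← hpb, hilbertDist_eq_chordArc hopen hconv hbdd hpC (by linarith) (hpb ▸ hb)] at hdb
  rw [← hpa, hilbertDist_eq_neg_chordArc hopen hconv hbdd hpC (by linarith) (hpa ▸ ha)] at hda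
  have he0 : e ≠ 0 := by
    intro h
    simp [h] at hdet
  have ha' := funk_pos hopen hbdd hpC (neg_ne_zero.2 he0)
  have hb' := funk_pos hopen hbdd hpC he0
  have hle := fun τ hτ => hilbertDist_le_abs_chordArc hopen hconv hbdd hpC (htC τ hτ)
  have hlo := fun τ hτ => one_sub_funk_mul_pos hopen hconv hpC (htC τ hτ)
  have hlo' := fun τ hτ => one_add_funk_mul_pos hopen hconv hpC (htC τ hτ)
  obtain ⟨l, hl, hlb⟩ := exists_support hopen hconv hbdd hpC e
  obtain ⟨l', hl', hla⟩ := exists_support hopen hconv hbdd hpC (-e)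
  generalize funk C p e = b' at *
  generalize funk C p (-e) = a' at *
  rw [map_neg, neg_eq_iff_eq_neg] at hla
  have hcont : ContinuousOn (chordArc a' b') (Set.Icc (-s) (1 - s)) := fun τ hτ =>
    (hasDerivAt_chordArc (hlo' τ hτ) (hlo τ hτ)).continuousAt.continuousWithinAt
  have h00 : chordArc a' b' 0 = 0 := by simp [chordArc]
  obtain ⟨τ₁, hτ₁, hδ1⟩ := intermediate_value_Icc (a := 0) (b := 1 - s) (by linarith)
    (hcont.mono (Set.Icc_subset_Icc_left (by linarith))) ⟨h00.trans_le hδ, hdb.le⟩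
  obtain ⟨τ₂, hτ₂, hδ2⟩ := intermediate_value_Icc (a := -s) (b := 0) (by linarith)
    (hcont.mono (Set.Icc_subset_Icc_right (by linarith)))
    (show -δ ∈ Set.Icc _ _ from ⟨by linarith, by linarith⟩)
  have hm1 : τ₁ ∈ Set.Icc (-s) (1 - s) := ⟨by linarith [hτ₁.1], hτ₁.2⟩
  have hm2 : τ₂ ∈ Set.Icc (-s) (1 - s) := ⟨hτ₂.1, by linarith [hτ₂.2]⟩
  let κ : ℝ := (l' (c - p) - l (c - p)) / (a' + b')
  let w : ℝ × ℝ := (c - p) + κ • e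
  have hlw : l w = - -(l w) := (neg_neg _).symm
  have hlw' : l' w = - -(l w) := by
    have : κ * (a' + b') = l' (c - p) - l (c - p) := div_mul_cancel₀ _ (by positivity)
    simp only [w, map_add, map_smul, smul_eq_mul, hla, hlb]
    linarith
  generalize -(l w) = c0 at *
  refine le_hilbertMeasure_of_fibers (e := e) (w := w) hopen hconv hbdd ?_ hl hl' hlb hla hlw hlw'
    ha' hb' ?_ ?_ hδ (hτ₂.2.trans hτ₁.1) (hlo _ hm1) (hlo' _ hm2) hδ1 hδ2 ?_
  · convert hdet using 1
    simp only [w, ← hp, Prod.fst_add, Prod.snd_add, Prod.fst_sub, Prod.snd_sub, Prod.smul_fst,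
      Prod.smul_snd, smul_eq_mul]
    ring
  · exact ((Set.toFinite {a, b, c}).isCompact_convexHull ℝ).measurableSet
  · refine convexHull_min ?_ hconv
    rintro x (rfl | rfl | rfl) <;> assumption
  intro τ hτ
  have hτm : τ ∈ Set.Ioo (-s) (1 - s) := ⟨hτ₂.1.trans_lt hτ.1, hτ.2.trans_le hτ₁.2⟩
  let k := κ + c0 * τ
  have hfan : ∀ y, fan p e w c0 (τ, y) = ((1 - s - τ) - y * (1 - s + k)) • a +
      ((s + τ) + y * (k - s)) • b + y • c := by
    intro y
    simp only [fan_eq, w, k, ← hp, he]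
    module
  have hfan0 : fan p e w c0 (τ, 0) = p + τ • e := by simp [fan]
  obtain ⟨Y, hY, hY0⟩ := intermediate_value_Icc' (zero_le_one (α := ℝ))
    (f := fun y => min ((1 - s - τ) - y * (1 - s + k)) ((s + τ) + y * (k - s)))
    (by fun_prop) (show (0 : ℝ) ∈ Set.Icc _ _ by
      refine ⟨?_, ?_⟩
      · rcases le_total (1 - s - τ - (1 - s + k)) 0 with h | h
        · exact (min_le_left _ _).trans (by linarith)
        · exact (min_le_right _ _).trans (by linarith)
      · simp only [zero_mul, sub_zero, add_zero]
        exact le_min (by linarith [hτm.2]) (by linarith [hτm.1]))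
  have hYpos : 0 < Y := by
    rcases eq_or_lt_of_le hY.1 with h | h
    · subst h
      have : 0 < min (1 - s - τ) (s + τ) := lt_min (by linarith [hτm.2]) (by linarith [hτm.1])
      simp only [zero_mul, sub_zero, add_zero] at hY0
      linarith
    · exact h
  beta_reduce at hY0
  have hYa : 0 ≤ (1 - s - τ) - Y * (1 - s + k) := hY0.symm.le.trans (min_le_left _ _)
  have hYb : 0 ≤ (s + τ) + Y * (k - s) := hY0.symm.le.trans (min_le_right _ _)
  have hside : fan p e w c0 (τ, Y) ∈ segment ℝ b c ∪ segment ℝ c a := by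
    rw [hfan]
    rcases min_choice ((1 - s - τ) - Y * (1 - s + k)) ((s + τ) + Y * (k - s)) with h | h
    · rw [hY0] at h
      left
      rw [← h, zero_smul, zero_add]
      exact ⟨_, _, hYb, hY.1, by linarith, rfl⟩
    · rw [hY0] at h
      right
      rw [← h, zero_smul, add_zero, add_comm]
      exact ⟨_, _, hY.1, hYa, by linarith, rfl⟩
  have hm : p + τ • e ∈ C := htC τ ⟨hτm.1.le, hτm.2.le⟩
  have hsideC : fan p e w c0 (τ, Y) ∈ C :=
    Set.union_subset (hconv.segment_subset hb hc) (hconv.segment_subset hc ha) hside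
  refine ⟨Y, hYpos, fun y hy => ?_, hfan0 ▸ hm, hsideC, ?_⟩
  · rw [hfan]
    have hθ : 0 ≤ y / Y := div_nonneg hy.1.le hYpos.le
    have hθ1 : y / Y ≤ 1 := (div_le_one hYpos).2 hy.2.le
    have hyY : y = y / Y * Y := by field_simp
    refine mem_convexHull_triple.2 ⟨_, _, _, ?_, ?_, hy.1.le, by ring, rfl⟩
    · rw [hyY]; nlinarith [hτm.2]
    · rw [hyY]; nlinarith [hτm.1]
  · have := hilbertDist_triangle hopen hconv hbdd hpC hm hsideC
    have h1 := hle τ ⟨hτm.1.le, hτm.2.le⟩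
    have h2 := hfar _ hside
    rw [hfan0]
    linarith

end Triangle

section Ideal

lemma exists_add_smul_mem_frontier {E : Type*} [NormedAddCommGroup E] [NormedSpace ℝ E]
    {C : Set E} {p v : E} (hopen : IsOpen C) (hconv : Convex ℝ C)
    (hbdd : Bornology.IsBounded C) (hp : p ∈ C) (hv : v ≠ 0) (hpv : p + v ∈ C) :
    ∃ t > (1 : ℝ), p + t • v ∈ frontier C := by
  have hf := funk_pos hopen hbdd hp hv
  refine ⟨(funk C p v)⁻¹, (one_lt_inv₀ hf).2 ((funk_lt_one_iff hopen hconv hp).2 hpv), ?_⟩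
  rw [hopen.frontier_eq]
  constructor
  · have ht : Filter.Tendsto (fun t : ℝ => p + t • (funk C p v)⁻¹ • v) (nhdsWithin 1 (Set.Ioo 0 1))
        (nhds (p + (1 : ℝ) • (funk C p v)⁻¹ • v)) :=
      (Continuous.tendsto (by fun_prop) 1).mono_left nhdsWithin_le_nhds
    rw [one_smul] at ht
    have : (nhdsWithin (1 : ℝ) (Set.Ioo 0 1)).NeBot := by
      rw [← mem_closure_iff_nhdsWithin_neBot, closure_Ioo (by norm_num)]
      simp
    refine mem_closure_of_tendsto ht ?_
    filter_upwards [self_mem_nhdsWithin] with t ht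
    rw [← funk_lt_one_iff hopen hconv hp, smul_smul,
      funk_smul (mul_nonneg ht.1.le (inv_nonneg.2 hf.le)), inv_mul_cancel_right₀ hf.ne']
    exact ht.2
  · rw [← funk_lt_one_iff hopen hconv hp, funk_smul (inv_nonneg.2 hf.le), inv_mul_cancel₀ hf.ne']
    exact lt_irrefl _

variable {C : Set (ℝ × ℝ)} {a b c x y z : ℝ × ℝ}

lemma not_collinear_of_det_ne_zero (ha : a ∈ convexHull ℝ ({x, y, z} : Set (ℝ × ℝ)))
    (hb : b ∈ convexHull ℝ ({x, y, z} : Set (ℝ × ℝ)))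
    (hc : c ∈ convexHull ℝ ({x, y, z} : Set (ℝ × ℝ)))
    (hdet : (b - a).1 * (c - a).2 - (c - a).1 * (b - a).2 ≠ 0) :
    ¬ Collinear ℝ ({x, y, z} : Set (ℝ × ℝ)) := by
  intro h
  obtain ⟨q, v, h⟩ := (collinear_iff_exists_forall_eq_smul_vadd (k := ℝ) _).1 h
  obtain ⟨rx, hx⟩ := h x (by simp)
  obtain ⟨ry, hy⟩ := h y (by simp)
  obtain ⟨rz, hz⟩ := h z (by simp)
  have key : ∀ r ∈ convexHull ℝ ({x, y, z} : Set (ℝ × ℝ)), ∃ s : ℝ, r = q + s • v := by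
    intro r hr
    obtain ⟨α, β, γ, -, -, -, hs, rfl⟩ := mem_convexHull_triple.1 hr
    refine ⟨α * rx + β * ry + γ * rz, ?_⟩
    obtain rfl : α = 1 - β - γ := by linarith
    rw [hx, hy, hz]
    simp only [vadd_eq_add]
    module
  obtain ⟨ra, rfl⟩ := key a ha
  obtain ⟨rb, rfl⟩ := key b hb
  obtain ⟨rc, rfl⟩ := key c hc
  apply hdet
  simp
  ring

lemma isIdealTriangle_of_strictConvex (hopen : IsOpen C) (hconv : Convex ℝ C)
    (hsc : StrictConvex ℝ (closure C)) (hx : x ∈ frontier C) (hy : y ∈ frontier C)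
    (hz : z ∈ frontier C) (hncol : ¬ Collinear ℝ ({x, y, z} : Set (ℝ × ℝ))) :
    IsIdealTriangle C x y z := by
  refine ⟨hx, hy, hz, hncol, Set.Subset.antisymm ?_ ?_⟩
  swap
  · refine Set.subset_inter (subset_convexHull _ _) ?_
    rintro q (rfl | rfl | rfl) <;> assumption
  have hxc := frontier_subset_closure hx
  have hyc := frontier_subset_closure hy
  have hzc := frontier_subset_closure hz
  have hint : interior (closure C) = C := by
    rw [hconv.interior_closure_eq_interior_of_nonempty_interior, hopen.interior_eq]
    rw [hopen.interior_eq]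
    exact closure_nonempty_iff.1 ⟨x, hxc⟩
  rintro q ⟨hq, hqf⟩
  rw [hopen.frontier_eq] at hqf
  obtain ⟨α, β, γ, hα, hβ, hγ, hs, rfl⟩ := mem_convexHull_triple.1 hq
  have hne : ∀ {u v : ℝ × ℝ}, u ∈ closure C → v ∈ closure C → u ≠ v → ∀ {s t : ℝ}, 0 ≤ s → 0 ≤ t →
      s + t = 1 → s • u + t • v ∉ C → s = 0 ∨ t = 0 := by
    intro u v hu hv huv s t hs ht hst h
    by_contra! hcon
    exact h (hint ▸ hsc hu hv huv (lt_of_le_of_ne hs hcon.1.symm) (lt_of_le_of_ne ht hcon.2.symm)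
      hst)
  have hyz : y ≠ z := by
    rintro rfl
    simp [collinear_pair] at hncol
  rcases eq_or_lt_of_le (show 0 ≤ β + γ by linarith) with h | h
  · obtain rfl : β = 0 := by linarith
    obtain rfl : γ = 0 := by linarith
    obtain rfl : α = 1 := by linarith
    simp
  rcases eq_or_lt_of_le hα with rfl | hα
  · rw [zero_smul, zero_add] at hqf ⊢
    rcases hne hyc hzc hyz hβ hγ (by linarith) hqf.2 with rfl | rfl
    · obtain rfl : γ = 1 := by linarith
      simp
    · obtain rfl : β = 1 := by linarith
      simp
  exfalso
  have hr : (β / (β + γ)) • y + (γ / (β + γ)) • z ∈ segment ℝ y z :=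
    ⟨_, _, div_nonneg hβ h.le, div_nonneg hγ h.le, by field_simp, rfl⟩
  have hxr : x ≠ (β / (β + γ)) • y + (γ / (β + γ)) • z := by
    intro hxr
    rw [← hxr] at hr
    refine hncol ?_
    rw [Set.insert_comm]
    exact (mem_segment_iff_wbtw.1 hr).collinear
  have hα1 : α + (β + γ) = 1 := by linarith
  have := hne hxc (hsc.convex.segment_subset hyc hzc hr) hxr hα.le h.le hα1 (by
    rw [smul_add, smul_smul, smul_smul, mul_div_cancel₀ _ h.ne', mul_div_cancel₀ _ h.ne',
      ← add_assoc]
    exact hqf.2)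
  rcases this with h' | h' <;> linarith

lemma exists_isIdealTriangle_superset (hopen : IsOpen C) (hconv : Convex ℝ C)
    (hbdd : Bornology.IsBounded C) (hsc : StrictConvex ℝ (closure C))
    (ha : a ∈ C) (hb : b ∈ C) (hc : c ∈ C)
    (hdet : (b - a).1 * (c - a).2 - (c - a).1 * (b - a).2 ≠ 0) :
    ∃ x y z, IsIdealTriangle C x y z ∧
      convexHull ℝ ({a, b, c} : Set (ℝ × ℝ)) ⊆ convexHull ℝ ({x, y, z} : Set (ℝ × ℝ)) := by
  have hab : b - a ≠ 0 := fun h => hdet (by simp [h])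
  have hca : a - c ≠ 0 := fun h => hdet (by rw [sub_eq_zero.1 h]; simp)
  have hbc : c - b ≠ 0 := fun h => hdet (by rw [sub_eq_zero.1 h]; ring)
  have exit : ∀ {a b : ℝ × ℝ}, a ∈ C → b ∈ C → b - a ≠ 0 →
      ∃ x ∈ frontier C, ∃ u : ℝ, 0 < u ∧ u < 1 ∧ b = u • a + (1 - u) • x := by
    intro a b ha hb hab
    obtain ⟨t, ht, hx⟩ := exists_add_smul_mem_frontier hopen hconv hbdd ha hab (by simpa using hb)
    have ht0 : 0 < t := by linarith
    refine ⟨_, hx, 1 - t⁻¹, by linarith [inv_lt_one_of_one_lt₀ ht], by linarith [inv_pos.2 ht0], ?_⟩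
    have h1 : t⁻¹ * t = 1 := inv_mul_cancel₀ ht0.ne'
    rw [sub_sub_cancel, smul_add, smul_smul, h1]
    module
  obtain ⟨x, hx, u, hu0, hu1, hxu⟩ := exit ha hb hab
  obtain ⟨y, hy, v, hv0, hv1, hyv⟩ := exit hb hc hbc
  obtain ⟨z, hz, w, hw0, hw1, hzw⟩ := exit hc ha hca
  have hcv := convex_convexHull ℝ ({x, y, z} : Set (ℝ × ℝ))
  have hxm : x ∈ convexHull ℝ ({x, y, z} : Set (ℝ × ℝ)) := subset_convexHull _ _ (by simp)
  have hym : y ∈ convexHull ℝ ({x, y, z} : Set (ℝ × ℝ)) := subset_convexHull _ _ (by simp)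
  have huv : u * v < 1 := mul_lt_one_of_nonneg_of_lt_one_left hu0.le hu1 hv1.le
  have huvw : u * v * w < 1 := mul_lt_one_of_nonneg_of_lt_one_left (by positivity) huv hw1.le
  have hD : 0 < 1 - u * v * w := by linarith
  have ham : a ∈ convexHull ℝ ({x, y, z} : Set (ℝ × ℝ)) := by
    have key : (1 - u * v * w) • a = (w * v * (1 - u)) • x + (w * (1 - v)) • y + (1 - w) • z := by
      have : a = w • (v • (u • a + (1 - u) • x) + (1 - v) • y) + (1 - w) • z := by
        rw [← hxu, ← hyv, ← hzw]
      calc (1 - u * v * w) • a = a - (u * v * w) • a := by module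
        _ = (w • (v • (u • a + (1 - u) • x) + (1 - v) • y) + (1 - w) • z) - (u * v * w) • a := by
          rw [← this]
        _ = _ := by module
    obtain ⟨r, hr0, hr⟩ : ∃ r : ℝ, 0 ≤ r ∧ r * (1 - u * v * w) = 1 :=
      ⟨_, (inv_pos.2 hD).le, inv_mul_cancel₀ hD.ne'⟩
    refine mem_convexHull_triple.2 ⟨r * (w * v * (1 - u)), r * (w * (1 - v)), r * (1 - w),
      mul_nonneg hr0 (mul_nonneg (by positivity) (by linarith)),
      mul_nonneg hr0 (mul_nonneg hw0.le (by linarith)), mul_nonneg hr0 (by linarith),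
      by linear_combination hr, ?_⟩
    simp only [mul_smul r]
    rw [← smul_add, ← smul_add, ← key, smul_smul, hr, one_smul]
  have hbm : b ∈ convexHull ℝ ({x, y, z} : Set (ℝ × ℝ)) :=
    hxu ▸ hcv ham hxm hu0.le (by linarith) (by ring)
  have hcm : c ∈ convexHull ℝ ({x, y, z} : Set (ℝ × ℝ)) :=
    hyv ▸ hcv hbm hym hv0.le (by linarith) (by ring)
  refine ⟨x, y, z, isIdealTriangle_of_strictConvex hopen hconv hsc hx hy hz
    (not_collinear_of_det_ne_zero ham hbm hcm hdet), convexHull_min ?_ hcv⟩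
  rintro q (rfl | rfl | rfl) <;> assumption

end Ideal

section LowerBound

variable {C : Set (ℝ × ℝ)} {q : ℝ × ℝ}

lemma two_mul_abs_div_le_hilbertFinsler {E : Type*} [NormedAddCommGroup E] [NormedSpace ℝ E]
    {C : Set E} {q : E} (hopen : IsOpen C) (hconv : Convex ℝ C)
    (hbdd : Bornology.IsBounded C) (hq : q ∈ C) {l : E →L[ℝ] ℝ} {r s : ℝ}
    (hr : ∀ x ∈ C, r < l x) (hs : ∀ x ∈ C, l x < s) (v : E) :
    2 * |l v| / (s - r) ≤ hilbertFinsler C q v := by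
  have key : ∀ v, 2 * l v / (s - r) ≤ hilbertFinsler C q v ∨ l v < 0 := by
    intro v
    rcases lt_or_ge (l v) 0 with h | h
    · exact Or.inr h
    left
    have hl' : ∀ x ∈ C, (-l) x < -r := fun x hx => neg_lt_neg (hr x hx)
    refine le_trans ?_ (half_le_hilbertFinsler hopen hconv hbdd hq hs hl' v)
    have h1 : 0 < s - l q := sub_pos.2 (hs q hq)
    have h2 : 0 < l q - r := sub_pos.2 (hr q hq)
    have e : -r - (-l) q = l q - r := by simp; ring
    have e' : (-l) v = -l v := rfl
    have e'' : s - r = (s - l q) + (l q - r) := by ring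
    rw [e, e', e'']
    generalize s - l q = A at *
    generalize l q - r = B at *
    rw [neg_div, sub_neg_eq_add, div_add_div _ _ h1.ne' h2.ne', div_div,
      div_le_div_iff₀ (by positivity) (by positivity)]
    nlinarith [mul_nonneg h (sq_nonneg (A - B))]
  rcases le_total 0 (l v) with h | h
  · rw [abs_of_nonneg h]
    exact (key v).resolve_right (not_lt.2 h)
  · rw [abs_of_nonpos h, ← map_neg, ← hilbertFinsler_neg hopen hconv hbdd hq]
    exact (key (-v)).resolve_right (not_lt.2 (by simpa using h))

lemma exists_frontier_forall_lt {E : Type*} [NormedAddCommGroup E] [NormedSpace ℝ E]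
    [FiniteDimensional ℝ E] {C : Set E} (hopen : IsOpen C) (hconv : Convex ℝ C)
    (hbdd : Bornology.IsBounded C) (hne : C.Nonempty) {l : E →L[ℝ] ℝ} (hl : l ≠ 0) :
    ∃ x ∈ frontier C, ∀ q ∈ C, l q < l x := by
  have : ProperSpace E := FiniteDimensional.proper ℝ E
  obtain ⟨x, hx, hmax⟩ := (hbdd.isCompact_closure).exists_isMaxOn hne.closure
    l.continuous.continuousOn
  obtain ⟨v, hv⟩ : ∃ v, 0 < l v := by
    obtain ⟨v, hv⟩ := DFunLike.ne_iff.1 hl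
    rcases lt_or_gt_of_ne hv with h | h
    · exact ⟨-v, by simpa using h⟩
    · exact ⟨v, h⟩
  have hlt : ∀ q ∈ C, l q < l x := by
    intro q hq
    have hf : 0 ≤ funk C q v := funk_nonneg
    have hm : q + (funk C q v + 1)⁻¹ • v ∈ C := by
      rw [← funk_lt_one_iff hopen hconv hq, funk_smul (by positivity), inv_mul_lt_one₀ (by positivity)]
      linarith
    have := hmax (subset_closure hm)
    simp only [Set.mem_ofPred_eq, map_add, map_smul, smul_eq_mul] at this
    have : 0 < (funk C q v + 1)⁻¹ * l v := by positivity
    linarith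
  refine ⟨x, ?_, hlt⟩
  rw [hopen.frontier_eq]
  exact ⟨hx, fun h => lt_irrefl _ (hlt x h)⟩

/-- The standard open triangle. -/
def stdTriangle : Set (ℝ × ℝ) := {z | 0 < z.1 ∧ 0 < z.2 ∧ z.1 + z.2 < 1}

lemma volume_stdTriangle : volume stdTriangle = ENNReal.ofReal (1 / 2) := by
  have : stdTriangle = regionBetween (fun _ => (0 : ℝ)) (fun x => 1 - x) (Set.Ioo 0 1) := by
    ext z
    simp only [stdTriangle, regionBetween, Set.mem_ofPred_eq, Set.mem_Ioo]
    constructor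
    · rintro ⟨h1, h2, h3⟩
      exact ⟨⟨h1, by linarith⟩, h2, by linarith⟩
    · rintro ⟨⟨h1, -⟩, h2, h3⟩
      exact ⟨h1, h2, by linarith⟩
  rw [this, Measure.volume_eq_prod, volume_regionBetween_eq_integral]
  · congr 1
    rw [← integral_Ioc_eq_integral_Ioo, ← intervalIntegral.integral_of_le zero_le_one]
    simp only [Pi.sub_apply, sub_zero]
    rw [intervalIntegral.integral_sub (by simp) (by simp)]
    norm_num
  · exact integrableOn_const (by simp)
  · exact (Continuous.integrableOn_Icc (by fun_prop)).mono_set Set.Ioo_subset_Icc_self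
  · exact measurableSet_Ioo
  · intro x hx
    exact sub_nonneg.2 hx.2.le

lemma le_volume_convexHull_triple (a b c : ℝ × ℝ) :
    ENNReal.ofReal (|(b - a).1 * (c - a).2 - (c - a).1 * (b - a).2| / 2) ≤
      volume (convexHull ℝ ({a, b, c} : Set (ℝ × ℝ))) := by
  calc ENNReal.ofReal (|(b - a).1 * (c - a).2 - (c - a).1 * (b - a).2| / 2)
      = volume (frameMap (b - a) (c - a) '' stdTriangle) := by
        rw [Measure.addHaar_image_continuousLinearMap, volume_stdTriangle,
          ← ContinuousLinearMap.det, det_frameMap, ← ENNReal.ofReal_mul (abs_nonneg _)]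
        congr 1
        ring
    _ = volume ((fun x => a + x) '' (frameMap (b - a) (c - a) '' stdTriangle)) := by
        rw [Set.image_add_left, measure_preimage_add]
    _ ≤ _ := by
        refine measure_mono ?_
        rintro _ ⟨_, ⟨z, ⟨h1, h2, h3⟩, rfl⟩, rfl⟩
        refine mem_convexHull_triple.2 ⟨1 - z.1 - z.2, z.1, z.2, by linarith, h1.le, h2.le, by ring, ?_⟩
        rw [frameMap_apply]
        module

/-- The unit ball is contained in half the difference body of a circumscribed parallelogram. -/
lemma volume_hilbertUnitBall_le (hopen : IsOpen C) (hconv : Convex ℝ C)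
    (hbdd : Bornology.IsBounded C) (hq : q ∈ C) {r s r' s' w h : ℝ} (hw : 0 < w)
    (hws : s - r ≤ w)
    (hr : ∀ x ∈ C, r < x.1) (hs : ∀ x ∈ C, x.1 < s)
    (hr' : ∀ x ∈ C, r' < w * x.2 - h * x.1) (hs' : ∀ x ∈ C, w * x.2 - h * x.1 < s') :
    volume (hilbertUnitBall C q) ≤ ENNReal.ofReal (s' - r') := by
  let l : ℝ × ℝ →L[ℝ] ℝ := w • ContinuousLinearMap.snd ℝ ℝ ℝ - h • ContinuousLinearMap.fst ℝ ℝ ℝ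
  have h1 : ∀ v ∈ hilbertUnitBall C q, |v.1| < w / 2 := by
    intro v hv
    have := (two_mul_abs_div_le_hilbertFinsler hopen hconv hbdd hq
      (l := ContinuousLinearMap.fst ℝ ℝ ℝ) hr hs v).trans_lt hv
    rw [div_lt_one (by linarith [hr q hq, hs q hq])] at this
    simp only [ContinuousLinearMap.coe_fst'] at this
    linarith
  have h2 : ∀ v ∈ hilbertUnitBall C q, |w * v.2 - h * v.1| < (s' - r') / 2 := by
    intro v hv
    have := (two_mul_abs_div_le_hilbertFinsler hopen hconv hbdd hq (l := l) hr' hs' v).trans_lt hv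
    rw [div_lt_one (by linarith [hr' q hq, hs' q hq])] at this
    have e : l v = w * v.2 - h * v.1 := rfl
    rw [e] at this
    linarith
  refine (volume_le_of_slices (isOpen_hilbertUnitBall hopen hconv hbdd hq).measurableSet
    (r := w / 2) (d := (s' - r') / w) (by positivity) (fun v hv => (h1 v hv).le) ?_).trans_eq ?_
  · intro x y y' hy hy'
    rw [le_div_iff₀ hw, ← abs_of_pos hw, ← abs_mul]
    have e : (y - y') * w = (w * y - h * x) - (w * y' - h * x) := by ring
    rw [e]
    have := abs_sub (w * y - h * x) (w * y' - h * x)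
    linarith [h2 _ hy, h2 _ hy']
  · congr 1
    field_simp

lemma exists_isIdealTriangle_pi_div_four_le (hopen : IsOpen C) (hconv : Convex ℝ C)
    (hbdd : Bornology.IsBounded C) (hne : C.Nonempty) (hsc : StrictConvex ℝ (closure C)) :
    ∃ x y z, IsIdealTriangle C x y z ∧ ENNReal.ofReal (Real.pi / 4) ≤
      hilbertMeasure C (convexHull ℝ ({x, y, z} : Set (ℝ × ℝ))) := by
  have hfst : ContinuousLinearMap.fst ℝ ℝ ℝ ≠ 0 := fun h => by
    simpa using DFunLike.congr_fun h ((1 : ℝ), (0 : ℝ))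
  obtain ⟨B, hB, hB'⟩ := exists_frontier_forall_lt hopen hconv hbdd hne hfst
  obtain ⟨A, hA, hA'⟩ := exists_frontier_forall_lt hopen hconv hbdd hne (neg_ne_zero.2 hfst)
  replace hB' : ∀ q ∈ C, q.1 < B.1 := hB'
  replace hA' : ∀ q ∈ C, A.1 < q.1 := fun q hq => neg_lt_neg_iff.1 (hA' q hq)
  have hw : 0 < B.1 - A.1 := by
    obtain ⟨q, hq⟩ := hne
    linarith [hA' q hq, hB' q hq]
  let l : ℝ × ℝ →L[ℝ] ℝ := (B.1 - A.1) • ContinuousLinearMap.snd ℝ ℝ ℝ -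
    (B.2 - A.2) • ContinuousLinearMap.fst ℝ ℝ ℝ
  have hle : ∀ v, l v = (B.1 - A.1) * v.2 - (B.2 - A.2) * v.1 := fun v => rfl
  have hl : l ≠ 0 := fun h => by
    have := DFunLike.congr_fun h ((0 : ℝ), (1 : ℝ))
    rw [hle] at this
    simp at this
    linarith
  obtain ⟨U, hU, hU'⟩ := exists_frontier_forall_lt hopen hconv hbdd hne hl
  obtain ⟨L, hL, hL'⟩ := exists_frontier_forall_lt hopen hconv hbdd hne (neg_ne_zero.2 hl)
  replace hL' : ∀ q ∈ C, l L < l q := fun q hq => neg_lt_neg_iff.1 (hL' q hq)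
  have hH : 0 < l U - l L := by
    obtain ⟨q, hq⟩ := hne
    linarith [hU' q hq, hL' q hq]
  have hdet : ∀ E, (B - A).1 * (E - A).2 - (E - A).1 * (B - A).2 = l E - l A := by
    intro E
    simp only [hle, Prod.fst_sub, Prod.snd_sub]
    ring
  obtain ⟨E, hE, hE'⟩ : ∃ E ∈ frontier C, l U - l L ≤ 2 * |l E - l A| := by
    rcases le_total (l U - l A) (l A - l L) with h | h
    · exact ⟨L, hL, by linarith [neg_le_abs (l L - l A)]⟩
    · exact ⟨U, hU, by linarith [le_abs_self (l U - l A)]⟩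
  have hdet0 : (B - A).1 * (E - A).2 - (E - A).1 * (B - A).2 ≠ 0 := by
    rw [hdet]
    intro h
    rw [h, abs_zero] at hE'
    linarith
  have hT := isIdealTriangle_of_strictConvex hopen hconv hsc hA hB hE
    (not_collinear_of_det_ne_zero (subset_convexHull _ _ (by simp)) (subset_convexHull _ _ (by simp))
      (subset_convexHull _ _ (by simp)) hdet0)
  refine ⟨A, B, E, hT, ?_⟩
  have hsub : convexHull ℝ ({A, B, E} : Set (ℝ × ℝ)) \ {A, B, E} ⊆ C := by
    rintro q ⟨hq, hqn⟩
    by_contra hqC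
    refine hqn (hT.2.2.2.2 ▸ ⟨hq, ?_⟩)
    rw [hopen.frontier_eq]
    refine ⟨convexHull_min ?_ hconv.closure hq, hqC⟩
    rintro x (rfl | rfl | rfl) <;> exact frontier_subset_closure (by assumption)
  have hfin : ({A, B, E} : Set (ℝ × ℝ)).Finite := Set.toFinite _
  calc ENNReal.ofReal (Real.pi / 4)
      ≤ ENNReal.ofReal Real.pi / ENNReal.ofReal (l U - l L) *
        ENNReal.ofReal (|(B - A).1 * (E - A).2 - (E - A).1 * (B - A).2| / 2) := by
        rw [hdet, ← ENNReal.ofReal_div_of_pos hH, ← ENNReal.ofReal_mul (by positivity)]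
        refine ENNReal.ofReal_le_ofReal ?_
        rw [div_mul_div_comm, div_le_div_iff₀ (by norm_num) (by positivity)]
        nlinarith [Real.pi_pos]
    _ ≤ ENNReal.ofReal Real.pi / ENNReal.ofReal (l U - l L) *
        volume (convexHull ℝ ({A, B, E} : Set (ℝ × ℝ)) \ {A, B, E}) := by
        rw [measure_sdiff_null (hfin.measure_zero volume)]
        gcongr
        exact le_volume_convexHull_triple A B E
    _ = ∫⁻ _ in convexHull ℝ ({A, B, E} : Set (ℝ × ℝ)) \ {A, B, E},
          ENNReal.ofReal Real.pi / ENNReal.ofReal (l U - l L) := by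
        rw [setLIntegral_const]
    _ ≤ hilbertMeasure C (convexHull ℝ ({A, B, E} : Set (ℝ × ℝ)) \ {A, B, E}) := by
        refine setLIntegral_mono' ((hfin.isCompact_convexHull ℝ).measurableSet.diff
          hfin.measurableSet) fun q hq => ?_
        exact ENNReal.div_le_div_left (volume_hilbertUnitBall_le hopen hconv hbdd (hsub hq) hw le_rfl
          hA' hB' hL' hU') _
    _ ≤ _ := hilbertMeasure_mono Set.sdiff_subset

end LowerBound

section Simplex

lemma isOpen_stdTriangle : IsOpen stdTriangle :=
  (isOpen_lt continuous_const continuous_fst).inter ((isOpen_lt continuous_const continuous_snd).inter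
    (isOpen_lt (continuous_fst.add continuous_snd) continuous_const))

lemma convex_stdTriangle : Convex ℝ stdTriangle := by
  rintro x ⟨hx1, hx2, hx3⟩ y ⟨hy1, hy2, hy3⟩ s t hs ht hst
  have key : ∀ u v : ℝ, 0 < u → 0 < v → 0 < s * u + t * v := by
    intro u v hu hv
    rcases eq_or_lt_of_le hs with rfl | hs
    · obtain rfl : t = 1 := by linarith
      linarith
    · have := mul_pos hs hu
      have := mul_nonneg ht hv.le
      linarith
  refine ⟨key _ _ hx1 hy1, key _ _ hx2 hy2, ?_⟩
  have := key _ _ (sub_pos.2 hx3) (sub_pos.2 hy3)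
  simp only [Prod.fst_add, Prod.snd_add, Prod.smul_fst, Prod.smul_snd, smul_eq_mul]
  linarith

lemma isBounded_stdTriangle : Bornology.IsBounded stdTriangle := by
  refine (Metric.isBounded_Icc (0 : ℝ × ℝ) 1).subset ?_
  rintro z ⟨h1, h2, h3⟩
  exact ⟨⟨h1.le, h2.le⟩, by simp only [Prod.fst_one]; linarith, by simp only [Prod.snd_one]; linarith⟩

/-- The hexagon which is the unit ball of the Hilbert geometry of a triangle in logarithmic
coordinates, up to a factor of two. -/
def hexagon : Set (ℝ × ℝ) := {z | |z.1| < 2 ∧ |z.2| < 2 ∧ |z.1 - z.2| < 2}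

lemma isOpen_hexagon : IsOpen hexagon :=
  (isOpen_lt continuous_fst.abs continuous_const).inter
    ((isOpen_lt continuous_snd.abs continuous_const).inter
      (isOpen_lt (continuous_fst.sub continuous_snd).abs continuous_const))

lemma volume_hexagon_ne_zero : volume hexagon ≠ 0 :=
  (isOpen_hexagon.measure_pos volume ⟨0, by simp [hexagon]⟩).ne'

lemma volume_hexagon_ne_top : volume hexagon ≠ ⊤ := by
  refine ((Metric.isBounded_ball (x := (0 : ℝ × ℝ)) (r := 2)).subset ?_).measure_lt_top.ne
  rintro z ⟨h1, h2, -⟩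
  rw [mem_ball_zero_iff, Prod.norm_def]
  exact max_lt h1 h2

lemma funk_stdTriangle_lt {q u : ℝ × ℝ} (hq : q ∈ stdTriangle) {r : ℝ} (hr : 0 < r)
    (h1 : -u.1 < r * q.1) (h2 : -u.2 < r * q.2) (h3 : u.1 + u.2 < r * (1 - q.1 - q.2)) :
    funk stdTriangle q u < r := by
  have hm : q + r⁻¹ • u ∈ stdTriangle := by
    refine ⟨?_, ?_, ?_⟩ <;>
      simp only [Prod.fst_add, Prod.snd_add, Prod.smul_fst, Prod.smul_snd, smul_eq_mul]
    · have := (inv_mul_lt_iff₀ hr).2 h1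
      linarith
    · have := (inv_mul_lt_iff₀ hr).2 h2
      linarith
    · have := (inv_mul_lt_iff₀ hr).2 h3
      linarith
  rw [← funk_lt_one_iff isOpen_stdTriangle convex_stdTriangle hq, funk_smul (inv_pos.2 hr).le,
    inv_mul_lt_iff₀ hr, mul_one] at hm
  exact hm

/-- Derivative of the logarithmic parametrization of the triangle, at the point with image `q`. -/
noncomputable def logFrame (q : ℝ × ℝ) : ℝ × ℝ →L[ℝ] ℝ × ℝ :=
  frameMap (q.1 * (1 - q.1), -(q.1 * q.2)) (-(q.1 * q.2), q.2 * (1 - q.2))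

lemma logFrame_image_subset {q : ℝ × ℝ} (hq : q ∈ stdTriangle) :
    logFrame q '' hexagon ⊆ hilbertUnitBall stdTriangle q := by
  rintro _ ⟨v, ⟨hv1, hv2, hv3⟩, rfl⟩
  obtain ⟨q1, q2, q3⟩ := hq
  rw [abs_lt] at hv1 hv2 hv3
  obtain ⟨α, β, hα1, hα2, hα0, hβ1, hβ2, hβ0, hαβ⟩ : ∃ α β : ℝ, α < v.1 ∧ α < v.2 ∧ α < 0 ∧
      v.1 < β ∧ v.2 < β ∧ 0 < β ∧ β - α ≤ 2 := by
    let m := min (min v.1 v.2) 0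
    let n := max (max v.1 v.2) 0
    have hm1 : m ≤ v.1 := (min_le_left _ _).trans (min_le_left _ _)
    have hm2 : m ≤ v.2 := (min_le_left _ _).trans (min_le_right _ _)
    have hm3 : m ≤ 0 := min_le_right _ _
    have hn1 : v.1 ≤ n := (le_max_left _ _).trans (le_max_left _ _)
    have hn2 : v.2 ≤ n := (le_max_right _ _).trans (le_max_left _ _)
    have hn3 : 0 ≤ n := le_max_right _ _
    have hnm : n < 2 + m := by
      refine max_lt (max_lt ?_ ?_) ?_ <;> rw [← sub_lt_iff_lt_add'] <;>
        refine lt_min (lt_min ?_ ?_) ?_ <;> linarith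
    exact ⟨m - (2 + m - n) / 2, n + (2 + m - n) / 2, by linarith, by linarith, by linarith,
      by linarith, by linarith, by linarith, by linarith⟩
  have e1 : (logFrame q v).1 = q.1 * (v.1 - (q.1 * v.1 + q.2 * v.2)) := by
    simp [logFrame, frameMap_apply]; ring
  have e2 : (logFrame q v).2 = q.2 * (v.2 - (q.1 * v.1 + q.2 * v.2)) := by
    simp [logFrame, frameMap_apply]; ring
  have q3' : 0 < 1 - q.1 - q.2 := by linarith
  have hmα : α < q.1 * v.1 + q.2 * v.2 := by
    linarith [mul_lt_mul_of_pos_left hα1 q1, mul_lt_mul_of_pos_left hα2 q2,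
      mul_lt_mul_of_pos_left hα0 q3']
  have hmβ : q.1 * v.1 + q.2 * v.2 < β := by
    linarith [mul_lt_mul_of_pos_left hβ1 q1, mul_lt_mul_of_pos_left hβ2 q2,
      mul_lt_mul_of_pos_left hβ0 q3']
  have f1 : funk stdTriangle q (logFrame q v) < q.1 * v.1 + q.2 * v.2 - α := by
    refine funk_stdTriangle_lt ⟨q1, q2, q3⟩ (sub_pos.2 hmα) ?_ ?_ ?_ <;> simp only [e1, e2]
    · linarith [mul_lt_mul_of_pos_left hα1 q1]
    · linarith [mul_lt_mul_of_pos_left hα2 q2]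
    · linarith [mul_lt_mul_of_pos_left hα0 q3']
  have f2 : funk stdTriangle q (-logFrame q v) < β - (q.1 * v.1 + q.2 * v.2) := by
    refine funk_stdTriangle_lt ⟨q1, q2, q3⟩ (sub_pos.2 hmβ) ?_ ?_ ?_ <;>
      simp only [Prod.fst_neg, Prod.snd_neg, e1, e2]
    · linarith [mul_lt_mul_of_pos_left hβ1 q1]
    · linarith [mul_lt_mul_of_pos_left hβ2 q2]
    · linarith [mul_lt_mul_of_pos_left hβ0 q3']
  change hilbertFinsler stdTriangle q _ < 1
  rw [hilbertFinsler_eq isOpen_stdTriangle convex_stdTriangle isBounded_stdTriangle ⟨q1, q2, q3⟩]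
  linarith

/-- Logarithmic parametrization of the standard triangle. -/
noncomputable def logParam (z : ℝ × ℝ) : ℝ × ℝ :=
  (Real.exp z.1 * (1 + Real.exp z.1 + Real.exp z.2)⁻¹,
    Real.exp z.2 * (1 + Real.exp z.1 + Real.exp z.2)⁻¹)

lemma one_sub_logParam (z : ℝ × ℝ) :
    1 - (logParam z).1 - (logParam z).2 = (1 + Real.exp z.1 + Real.exp z.2)⁻¹ := by
  have : 1 + Real.exp z.1 + Real.exp z.2 ≠ 0 := by positivity
  simp only [logParam]
  field_simp
  ring

lemma logParam_mem (z : ℝ × ℝ) : logParam z ∈ stdTriangle := by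
  refine ⟨by simp only [logParam]; positivity, by simp only [logParam]; positivity, ?_⟩
  have : 0 < 1 - (logParam z).1 - (logParam z).2 := by rw [one_sub_logParam]; positivity
  linarith

lemma logParam_injective : Function.Injective logParam := by
  intro z z' h
  have hS := one_sub_logParam z
  rw [h, one_sub_logParam, inv_inj] at hS
  have h1 := congrArg Prod.fst h
  have h2 := congrArg Prod.snd h
  simp only [logParam, hS] at h1 h2
  have : (1 + Real.exp z.1 + Real.exp z.2)⁻¹ ≠ 0 := by positivity
  exact Prod.ext (Real.exp_injective (mul_right_cancel₀ this h1))
    (Real.exp_injective (mul_right_cancel₀ this h2))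

lemma hasFDerivAt_logParam (z : ℝ × ℝ) : HasFDerivAt logParam (logFrame (logParam z)) z := by
  have h0 : 1 + Real.exp z.1 + Real.exp z.2 ≠ 0 := by positivity
  have h1 : HasFDerivAt (fun z : ℝ × ℝ => Real.exp z.1)
    (Real.exp z.1 • ContinuousLinearMap.fst ℝ ℝ ℝ) z := hasFDerivAt_fst.exp
  have h2 : HasFDerivAt (fun z : ℝ × ℝ => Real.exp z.2)
    (Real.exp z.2 • ContinuousLinearMap.snd ℝ ℝ ℝ) z := hasFDerivAt_snd.exp
  have h3 := (hasDerivAt_inv h0).comp_hasFDerivAt z ((h1.const_add 1).add h2)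
  refine ((h1.mul h3).prodMk (h2.mul h3)).congr_fderiv ?_
  apply ContinuousLinearMap.ext
  intro v
  ext <;> simp [logFrame, frameMap_apply, logParam] <;> field_simp <;> ring

lemma unitBall_stdTriangle_subset :
    {q ∈ stdTriangle | hilbertDist stdTriangle (1 / 3, 1 / 3) q < 1} ⊆ logParam '' hexagon := by
  rintro q ⟨hq, hd⟩
  have hp : ((1 / 3, 1 / 3) : ℝ × ℝ) ∈ stdTriangle := by
    refine ⟨?_, ?_, ?_⟩ <;> norm_num
  have key : ∀ {l l' : ℝ × ℝ →L[ℝ] ℝ} {s s' : ℝ}, (∀ x ∈ stdTriangle, l x < s) →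
      (∀ x ∈ stdTriangle, l' x < s') → s - l (1 / 3, 1 / 3) = 1 / 3 → s' - l' (1 / 3, 1 / 3) = 1 / 3 →
      Real.log (s' - l' q) - Real.log (s - l q) < 2 := by
    intro l l' s s' hl hl' e e'
    have := half_log_le_hilbertDist isOpen_stdTriangle convex_stdTriangle isBounded_stdTriangle hp hq
      hl hl'
    rw [e, e', div_div_div_cancel_right₀ (by norm_num),
      Real.log_div (sub_pos.2 (hl' q hq)).ne' (sub_pos.2 (hl q hq)).ne'] at this
    linarith
  let fst := ContinuousLinearMap.fst ℝ ℝ ℝ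
  let snd := ContinuousLinearMap.snd ℝ ℝ ℝ
  have b1 : ∀ x ∈ stdTriangle, (-fst) x < 0 := fun x hx => neg_lt_zero.2 hx.1
  have b2 : ∀ x ∈ stdTriangle, (-snd) x < 0 := fun x hx => neg_lt_zero.2 hx.2.1
  have b3 : ∀ x ∈ stdTriangle, (fst + snd) x < 1 := fun x hx => hx.2.2
  have v1 : ∀ x, 0 - (-fst) x = x.1 := fun x => by simp [fst]
  have v2 : ∀ x, 0 - (-snd) x = x.2 := fun x => by simp [snd]
  have v3 : ∀ x, 1 - (fst + snd) x = 1 - x.1 - x.2 := fun x => by simp [fst, snd]; ring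
  have k12 := key b1 b2 (v1 _) (v2 _)
  have k21 := key b2 b1 (v2 _) (v1 _)
  have k13 := key b1 b3 (v1 _) ((v3 _).trans (by norm_num))
  have k31 := key b3 b1 ((v3 _).trans (by norm_num)) (v1 _)
  have k23 := key b2 b3 (v2 _) ((v3 _).trans (by norm_num))
  have k32 := key b3 b2 ((v3 _).trans (by norm_num)) (v2 _)
  rw [v1, v2] at k12 k21
  rw [v1, v3] at k13 k31
  rw [v2, v3] at k23 k32
  obtain ⟨q1, q2, q3⟩ := hq
  have q3' : 0 < 1 - q.1 - q.2 := by linarith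
  refine ⟨(Real.log q.1 - Real.log (1 - q.1 - q.2), Real.log q.2 - Real.log (1 - q.1 - q.2)),
    ⟨abs_lt.2 ⟨?_, ?_⟩, abs_lt.2 ⟨?_, ?_⟩, abs_lt.2 ⟨?_, ?_⟩⟩, ?_⟩
  iterate 6 dsimp only; linarith
  have e : ∀ u : ℝ, 0 < u → Real.exp (Real.log u - Real.log (1 - q.1 - q.2)) = u / (1 - q.1 - q.2) :=
    fun u hu => by rw [Real.exp_sub, Real.exp_log hu, Real.exp_log q3']
  have hs : 1 + q.1 / (1 - q.1 - q.2) + q.2 / (1 - q.1 - q.2) = (1 - q.1 - q.2)⁻¹ := by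
    field_simp
    ring
  simp only [logParam, e _ q1, e _ q2, hs, inv_inv, div_mul_cancel₀ _ q3'.ne']

lemma hilbertMeasure_unitBall_stdTriangle_le :
    hilbertMeasure stdTriangle {q ∈ stdTriangle | hilbertDist stdTriangle (1 / 3, 1 / 3) q < 1} ≤
      ENNReal.ofReal Real.pi := by
  calc _ ≤ hilbertMeasure stdTriangle (logParam '' hexagon) :=
        hilbertMeasure_mono unitBall_stdTriangle_subset
    _ = ∫⁻ z in hexagon, ENNReal.ofReal |(logFrame (logParam z)).det| *
          (ENNReal.ofReal Real.pi / volume (hilbertUnitBall stdTriangle (logParam z))) := by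
        rw [hilbertMeasure, lintegral_image_eq_lintegral_abs_det_fderiv_mul volume
          isOpen_hexagon.measurableSet (fun z _ => (hasFDerivAt_logParam z).hasFDerivWithinAt)
          logParam_injective.injOn]
    _ ≤ ∫⁻ _ in hexagon, ENNReal.ofReal Real.pi / volume hexagon := by
        refine lintegral_mono fun z => ?_
        have h : ENNReal.ofReal |(logFrame (logParam z)).det| * volume hexagon ≤
            volume (hilbertUnitBall stdTriangle (logParam z)) := by
          have := measure_mono (μ := volume) (logFrame_image_subset (logParam_mem z))
          rwa [Measure.addHaar_image_continuousLinearMap] at this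
        generalize hd : ENNReal.ofReal |(logFrame (logParam z)).det| = d at *
        have hdt : d ≠ ⊤ := hd ▸ ENNReal.ofReal_ne_top
        rcases eq_or_ne d 0 with rfl | hd0
        · simp
        calc d * (ENNReal.ofReal Real.pi / volume (hilbertUnitBall stdTriangle (logParam z)))
            ≤ d * (ENNReal.ofReal Real.pi / (d * volume hexagon)) := by gcongr
          _ = ENNReal.ofReal Real.pi / volume hexagon := by
            rw [← mul_div_assoc, ENNReal.mul_div_mul_left _ _ hd0 hdt]
    _ = ENNReal.ofReal Real.pi := by
        rw [setLIntegral_const, ENNReal.div_mul_cancel volume_hexagon_ne_zero volume_hexagon_ne_top]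

end Simplex

theorem stmt_19 (C : Set (ℝ × ℝ)) (hopen : IsOpen C) (hconv : Convex ℝ C)
    (hbdd : Bornology.IsBounded C) (hne : C.Nonempty)
    (M c₂ : ℝ) (hM : 0 < M) (hc₂ : 0 < c₂)
    (hArea : ∀ x y z : ℝ × ℝ, IsIdealTriangle C x y z →
      hilbertMeasure C (convexHull ℝ ({x, y, z} : Set (ℝ × ℝ))) ≤ ENNReal.ofReal M)
    (hBall1 : ∀ D : Set (ℝ × ℝ), IsOpen D → Convex ℝ D → Bornology.IsBounded D →
      D.Nonempty → ∀ p ∈ D,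
        ENNReal.ofReal c₂ ≤ hilbertMeasure D {q ∈ D | hilbertDist D p q < 1})
    (hNonStrict : ¬ StrictConvex ℝ (closure C) →
      ∀ N : ℝ, ∃ x y z : ℝ × ℝ, IsIdealTriangle C x y z ∧
        ENNReal.ofReal N < hilbertMeasure C (convexHull ℝ ({x, y, z} : Set (ℝ × ℝ))))
    (hFail : ∀ δ : ℝ, 0 < δ → ¬ IsDeltaHyperbolic C δ →
      ∃ x y z : ℝ × ℝ, IsIdealTriangle C x y z ∧
        ∃ p ∈ convexHull ℝ ({x, y, z} : Set (ℝ × ℝ)),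
          {q ∈ C | hilbertDist C p q < δ / 4} ⊆ convexHull ℝ ({x, y, z} : Set (ℝ × ℝ)))
    (hBallR : ∀ p ∈ C, ∀ R : ℝ, 2 ≤ R →
      ENNReal.ofReal (R * c₂ / 2) ≤ hilbertMeasure C {q ∈ C | hilbertDist C p q < R}) :
    ∀ δ : ℝ, 4 * M / c₂ < δ → IsDeltaHyperbolic C δ := by
  have hsc : StrictConvex ℝ (closure C) := by
    by_contra h
    obtain ⟨x, y, z, hT, hlt⟩ := hNonStrict h M
    exact absurd (hArea x y z hT) (not_le.2 hlt)
  have hc₂π : c₂ ≤ Real.pi := by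
    have hp : ((1 / 3, 1 / 3) : ℝ × ℝ) ∈ stdTriangle := by
      refine ⟨?_, ?_, ?_⟩ <;> norm_num
    exact (ENNReal.ofReal_le_ofReal_iff Real.pi_pos.le).1
      ((hBall1 stdTriangle isOpen_stdTriangle convex_stdTriangle isBounded_stdTriangle ⟨_, hp⟩ _
        hp).trans hilbertMeasure_unitBall_stdTriangle_le)
  have hMπ : Real.pi / 4 ≤ M := by
    obtain ⟨x, y, z, hT, hle⟩ := exists_isIdealTriangle_pi_div_four_le hopen hconv hbdd hne hsc
    exact (ENNReal.ofReal_le_ofReal_iff hM.le).1 (hle.trans (hArea x y z hT))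
  intro δ hδ a ha b hb c hc p hp
  by_contra! hfar
  rw [div_lt_iff₀ hc₂] at hδ
  have hδ1 : 1 < δ := by
    by_contra! h
    nlinarith
  obtain ⟨x, y, z, hT, hsub⟩ := exists_isIdealTriangle_superset hopen hconv hbdd hsc ha hb hc
    (by
      rw [segment_eq_image'] at hp
      obtain ⟨s, ⟨hs0, hs1⟩, hs⟩ := hp
      exact det_ne_zero_of_far (zero_le_one.trans hδ1.le) hs0 hs1 hs.symm hfar)
  have h := ((le_hilbertMeasure_triangle hopen hconv hbdd ha hb hc hp (zero_le_one.trans hδ1.le)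
    hfar).trans (hilbertMeasure_mono hsub)).trans (hArea x y z hT)
  rw [ENNReal.ofReal_le_ofReal_iff hM.le] at h
  have h1 : c₂ * δ ≤ Real.pi * δ := by gcongr
  have h2 : Real.pi * δ ≤ Real.pi * δ ^ 2 := by
    have : δ ≤ δ ^ 2 := by nlinarith
    gcongr
  linarith
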